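/- arXiv:0809.5267 — 4 statements merged into one kernel-verified Lean document; each statement's English description precedes it below -/
import Mathlib

section
/- There exists a function ω : ℕ³ → ℕ with the following property. Let (R, m) be any Noetherian local ring of Krull dimension d ≥ 1, and for a nonunit x ∈ R define deg(x) as the least length of R/(xR + (y_1, …, y_{d−1})R) over all (d−1)-tuples y_1, …, y_{d−1} ∈ m (with deg(x) = 0 if x is a unit). Then for any x, y ∈ R with deg(x) and deg(y) finite, deg(xy) ≤ ω(e, deg(x), deg(y)), where e is the embedding dimension of R (the minimal number of generators of m). -/
/-!
STATEMENT 15: There is a function `ω : ℕ³ → ℕ` such that for every Noetherian local ring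
`(R, m)` of Krull dimension `d ≥ 1` and all `x, y ∈ R` of finite degree,
`deg(xy) ≤ ω(e, deg x, deg y)` where `e` is the embedding dimension of `R`.
Here `deg(x)` is `0` for a unit, and otherwise the least length of
`R/(xR + (y₁, …, y_{d−1})R)` over all `(d−1)`-tuples of elements of `m` (and `∞` if no
such quotient has finite length).
-/

universe u

/-- The length of a module, i.e. the longest chain of submodules. -/
noncomputable def modLength (R : Type u) (M : Type u) [Ring R] [AddCommGroup M]
    [Module R M] : WithBot ℕ∞ :=
  Order.krullDim (Submodule R M)

open Classical in
/-- The degree of an element `x` of a `d`-dimensional local ring: `0` for a unit, and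
otherwise the least length of `R/(xR + (y₁, …, y_{d−1})R)` over all `(d−1)`-tuples `y`
of elements of the maximal ideal. -/
noncomputable def rdeg (R : Type u) [CommRing R] [IsLocalRing R] (d : ℕ) (x : R) :
    WithBot ℕ∞ :=
  if IsUnit x then 0
  else ⨅ y : {y : Fin (d - 1) → R // ∀ i, y i ∈ IsLocalRing.maximalIdeal R},
    modLength R (R ⧸ Ideal.span ({x} ∪ Set.range y.1))

/-- The embedding dimension of a local ring: the minimal number of generators of its
maximal ideal. -/
noncomputable def embdim (R : Type u) [CommRing R] [IsLocalRing R] : ℕ :=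
  sInf {c : ℕ | ∃ s : Finset R, s.card = c ∧
    Ideal.span (s : Set R) = IsLocalRing.maximalIdeal R}

/-- The colength of an ideal: the length of the quotient ring as a module. -/
noncomputable def Ideal.colength {R : Type*} [CommRing R] (I : Ideal R) : ℕ∞ :=
  Module.length R (R ⧸ I)

namespace Ideal

variable {R : Type*} [CommRing R]

lemma colength_anti {I J : Ideal R} (h : I ≤ J) : J.colength ≤ I.colength := by
  rw [colength, colength, Module.length_quotient, Module.length_quotient]
  exact Order.coheight_anti h

lemma colength_add_one_le {I J : Ideal R} (h : I < J) : J.colength + 1 ≤ I.colength := by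
  rw [colength, colength, Module.length_quotient, Module.length_quotient]
  exact Order.coheight_add_one_le h

lemma colength_add_colength (I J : Ideal R) :
    I.colength + J.colength = (I ⊓ J).colength + (I ⊔ J).colength := by
  let f : (R ⧸ I ⊓ J) →ₗ[R] (R ⧸ I) × (R ⧸ J) :=
    (Submodule.factor inf_le_left).prod (Submodule.factor inf_le_right)
  let g : ((R ⧸ I) × (R ⧸ J)) →ₗ[R] R ⧸ I ⊔ J :=
    (Submodule.factor le_sup_left).coprod (-Submodule.factor le_sup_right)
  have hf : Function.Injective f := by
    rw [← LinearMap.ker_eq_bot, LinearMap.ker_eq_bot']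
    intro m hm
    obtain ⟨r, rfl⟩ := Submodule.Quotient.mk_surjective _ m
    rw [Prod.ext_iff] at hm
    obtain ⟨h₁, h₂⟩ := hm
    exact (Submodule.Quotient.mk_eq_zero _).2
      ⟨(Submodule.Quotient.mk_eq_zero I).1 h₁, (Submodule.Quotient.mk_eq_zero J).1 h₂⟩
  have hg : Function.Surjective g := by
    intro m
    obtain ⟨r, rfl⟩ := Submodule.Quotient.mk_surjective _ m
    refine ⟨(Submodule.Quotient.mk r, 0), ?_⟩
    simp [g]
  have hfg : Function.Exact f g := by
    rintro ⟨p, q⟩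
    obtain ⟨p, rfl⟩ := Submodule.Quotient.mk_surjective _ p
    obtain ⟨q, rfl⟩ := Submodule.Quotient.mk_surjective _ q
    have hgpq : g (Submodule.Quotient.mk p, Submodule.Quotient.mk q) =
        Submodule.Quotient.mk (p - q) := by
      simp [g, sub_eq_add_neg]
    rw [hgpq, Submodule.Quotient.mk_eq_zero]
    constructor
    · intro h
      obtain ⟨i, hi, j, hj, hij⟩ := Submodule.mem_sup.1 h
      refine ⟨Submodule.Quotient.mk (p - i), Prod.ext ?_ ?_⟩
      · refine (Submodule.Quotient.eq I).2 ?_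
        simpa using hi
      · refine (Submodule.Quotient.eq J).2 ?_
        have : (LinearMap.id (R := R) (p - i)) - q = j := by
          rw [LinearMap.id_apply]; linear_combination -hij
        rwa [this]
    · rintro ⟨r, hr⟩
      obtain ⟨r, rfl⟩ := Submodule.Quotient.mk_surjective _ r
      rw [Prod.ext_iff] at hr
      have h₁ := (Submodule.Quotient.eq I).1 hr.1
      have h₂ := (Submodule.Quotient.eq J).1 hr.2
      have : p - q = -(r - p) + (r - q) := by ring
      rw [this]
      exact add_mem (mem_sup_left (neg_mem h₁)) (mem_sup_right h₂)
  have := Module.length_eq_add_of_exact f g hf hg hfg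
  rwa [Module.length_prod] at this

lemma colength_sup_span_mul_le (I : Ideal R) (u v : R) :
    (I ⊔ span {u * v}).colength ≤ (I ⊔ span {u}).colength + (I ⊔ span {v}).colength := by
  have huv : I ⊔ span {u * v} ≤ I ⊔ span {u} :=
    sup_le_sup_left (span_singleton_le_span_singleton.2 ⟨v, rfl⟩) _
  have hmul : I ⊔ span {v} ≤ Submodule.comap (LinearMap.mulLeft R u) (I ⊔ span {u * v}) := by
    refine sup_le (fun r hr ↦ mem_sup_left (I.mul_mem_left u hr)) ?_
    rw [span_singleton_le_iff_mem]
    exact mem_sup_right (mem_span_singleton_self _)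
  let f : (R ⧸ I ⊔ span {v}) →ₗ[R] R ⧸ I ⊔ span {u * v} :=
    Submodule.mapQ _ _ (LinearMap.mulLeft R u) hmul
  let g : (R ⧸ I ⊔ span {u * v}) →ₗ[R] R ⧸ I ⊔ span {u} := Submodule.factor huv
  have hfg : Function.Exact (LinearMap.range f).subtype g := by
    intro p
    obtain ⟨p, rfl⟩ := Submodule.Quotient.mk_surjective _ p
    have hgp : g (Submodule.Quotient.mk p) = Submodule.Quotient.mk p := rfl
    rw [hgp, Submodule.Quotient.mk_eq_zero]
    constructor
    · intro h
      obtain ⟨i, hi, j, hj, hij⟩ := Submodule.mem_sup.1 h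
      obtain ⟨r, rfl⟩ := mem_span_singleton.1 hj
      refine ⟨⟨f (Submodule.Quotient.mk r), LinearMap.mem_range_self _ _⟩, ?_⟩
      refine (Submodule.Quotient.eq _).2 (mem_sup_left ?_)
      have : LinearMap.mulLeft R u r - p = -i := by
        rw [LinearMap.mulLeft_apply]; linear_combination hij
      rw [this]
      exact neg_mem hi
    · rintro ⟨⟨q, r, rfl⟩, hr⟩
      obtain ⟨r, rfl⟩ := Submodule.Quotient.mk_surjective _ r
      have h := huv ((Submodule.Quotient.eq _).1 hr)
      have : p = u * r - (LinearMap.mulLeft R u r - p) := by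
        rw [LinearMap.mulLeft_apply]; ring
      rw [this]
      exact sub_mem (mem_sup_right (mem_span_singleton.2 ⟨r, rfl⟩)) h
  have hlen := Module.length_eq_add_of_exact (LinearMap.range f).subtype g
    (Submodule.subtype_injective _) (Submodule.factor_surjective huv) hfg
  rw [colength, hlen, add_comm]
  gcongr
  · rfl
  · exact Module.length_le_of_surjective f.rangeRestrict f.surjective_rangeRestrict

lemma colength_sup_span_pow_le (I : Ideal R) (u : R) (n : ℕ) :
    (I ⊔ span {u ^ n}).colength ≤ n * (I ⊔ span {u}).colength := by
  induction n with
  | zero =>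
    have : I ⊔ span {u ^ 0} = ⊤ := by simp
    rw [this, colength, Module.length_eq_zero_iff.2 inferInstance]
    simp
  | succ n ih =>
    rw [pow_succ]
    refine (colength_sup_span_mul_le I _ _).trans ?_
    rw [Nat.cast_succ, add_mul, one_mul]
    gcongr

lemma mem_of_mem_sup_span_mul {I : Ideal R} {u x : R}
    (hu : u ∈ jacobson (⊥ : Ideal R)) (hx : x ∈ I ⊔ span {u * x}) : x ∈ I := by
  obtain ⟨i, hi, j, hj, hij⟩ := Submodule.mem_sup.1 hx
  obtain ⟨r, rfl⟩ := mem_span_singleton.1 hj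
  have hunit := mem_jacobson_bot.1 hu (-r)
  rw [← I.unit_mul_mem_iff_mem hunit]
  have : (u * -r + 1) * x = i := by linear_combination -hij
  rwa [this]

lemma lt_colength_of_pow_notMem {u : R} (hu : u ∈ jacobson (⊥ : Ideal R)) (n : ℕ)
    (I : Ideal R) (h : u ^ n ∉ I) : (n + 1 : ℕ) ≤ I.colength := by
  induction n generalizing I with
  | zero =>
    have hI : I < ⊤ := lt_top_iff_ne_top.2 fun hI ↦ h (hI ▸ Submodule.mem_top)
    simpa using le_add_self.trans (colength_add_one_le hI)
  | succ n ih =>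
    have hlt : I < I ⊔ span {u ^ (n + 1)} :=
      left_lt_sup.2 fun hle ↦ h (hle (mem_span_singleton_self _))
    have hn : u ^ n ∉ I ⊔ span {u ^ (n + 1)} := fun hmem ↦ by
      rw [pow_succ'] at hmem
      exact h (I.mem_of_dvd (pow_dvd_pow u n.le_succ) (mem_of_mem_sup_span_mul hu hmem))
    refine le_trans ?_ (colength_add_one_le hlt)
    rw [Nat.cast_succ]
    gcongr
    exact ih _ hn

lemma pow_mul_card_mem_sup_inf {ι : Type*} {u : R} {K : ℕ} (A : Ideal R) (J : ι → Ideal R)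
    (s : Finset ι) (h : ∀ i ∈ s, u ^ K ∈ A ⊔ J i) : u ^ (K * s.card) ∈ A ⊔ s.inf J := by
  classical
  induction s using Finset.induction_on with
  | empty => simp
  | insert i s hi ih =>
    have h₁ := h i (Finset.mem_insert_self i s)
    have h₂ := ih fun j hj ↦ h j (Finset.mem_insert_of_mem hj)
    rw [Finset.inf_insert, Finset.card_insert_of_notMem hi, mul_add, mul_one, pow_add, mul_comm]
    have hle : (A ⊔ J i) * (A ⊔ s.inf J) ≤ A ⊔ (J i ⊓ s.inf J) := by
      rw [sup_mul, mul_sup (J i)]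
      refine sup_le (le_sup_of_le_left ?_) ?_
      · exact mul_le_inf.trans inf_le_left
      · exact sup_le (le_sup_of_le_left (mul_le_inf.trans inf_le_right))
          (le_sup_of_le_right mul_le_inf)
    exact hle (mul_mem_mul h₁ h₂)

lemma mul_card_le_colength_inf {ι : Type*} {u : R} {K a N : ℕ} (I : Ideal R)
    (hI : (I ⊔ span {u}).colength ≤ a) (J : ι → Ideal R) (hIJ : ∀ i, I ≤ J i)
    (s : Finset ι) (hs : ∀ i ∈ s, (N : ℕ∞) ≤ (J i).colength)
    (hJ : ∀ i ∈ s, ∀ j ∈ s, i ≠ j → u ^ K ∈ J i ⊔ J j) :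
    ((N * s.card : ℕ) : ℕ∞) ≤ (s.inf J).colength + (a * K * s.card ^ 2 : ℕ) := by
  classical
  induction s using Finset.induction_on with
  | empty => simp
  | insert i s hi ih =>
    have h₁ := ih (fun j hj ↦ hs j (Finset.mem_insert_of_mem hj)) fun j hj k hk ↦
      hJ j (Finset.mem_insert_of_mem hj) k (Finset.mem_insert_of_mem hk)
    have hmem : u ^ (K * s.card) ∈ J i ⊔ s.inf J :=
      pow_mul_card_mem_sup_inf (J i) J s fun j hj ↦ hJ i (Finset.mem_insert_self i s) j
        (Finset.mem_insert_of_mem hj) (by rintro rfl; exact hi hj)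
    have h₂ : (J i ⊔ s.inf J).colength ≤ (K * s.card * a : ℕ) := by
      calc (J i ⊔ s.inf J).colength ≤ (I ⊔ span {u ^ (K * s.card)}).colength :=
            colength_anti (sup_le ((hIJ i).trans le_sup_left)
              ((span_singleton_le_iff_mem _).2 hmem))
        _ ≤ (K * s.card : ℕ) * (I ⊔ span {u}).colength := colength_sup_span_pow_le I u _
        _ ≤ (K * s.card : ℕ) * (a : ℕ∞) := by gcongr
        _ = (K * s.card * a : ℕ) := by push_cast; rfl
    have h₃ := hs i (Finset.mem_insert_self i s)
    rw [Finset.inf_insert, Finset.card_insert_of_notMem hi]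
    calc ((N * (s.card + 1) : ℕ) : ℕ∞) = N + (N * s.card : ℕ) := by push_cast; ring
      _ ≤ (J i).colength + ((s.inf J).colength + (a * K * s.card ^ 2 : ℕ)) := by gcongr
      _ = (J i ⊓ s.inf J).colength + (J i ⊔ s.inf J).colength
          + (a * K * s.card ^ 2 : ℕ) := by
        rw [← add_assoc, colength_add_colength]
      _ ≤ (J i ⊓ s.inf J).colength + (K * s.card * a : ℕ) + (a * K * s.card ^ 2 : ℕ) := by
        gcongr
      _ = (J i ⊓ s.inf J).colength + (K * s.card * a + a * K * s.card ^ 2 : ℕ) := by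
        rw [Nat.cast_add, add_assoc]
      _ ≤ (J i ⊓ s.inf J).colength + (a * K * (s.card + 1) ^ 2 : ℕ) := by
        gcongr
        nlinarith [Nat.zero_le (a * K), Nat.zero_le (a * K * s.card)]

/-- A family of elements that is pairwise coprime up to a fixed power of a parameter `u` modulo
`I` contains at most `a` members that are not uniformly bounded parameters modulo `I`. -/
lemma exists_colength_sup_span_le {ι : Type*} {u : R} (hu : u ∈ jacobson (⊥ : Ideal R))
    {K a : ℕ} (I : Ideal R) (hI : (I ⊔ span {u}).colength ≤ a) (w : ι → R)
    (s : Finset ι) (hcard : a < s.card)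
    (hw : ∀ i ∈ s, ∀ j ∈ s, i ≠ j → u ^ K ∈ I ⊔ span {w i} ⊔ span {w j}) :
    ∃ i ∈ s, (I ⊔ span {w i}).colength ≤ (a * (a * K * (a + 1) ^ 2) : ℕ) := by
  obtain ⟨t, hts, ht⟩ := Finset.exists_subset_card_eq (Nat.succ_le_of_lt hcard)
  set N := a * K * (a + 1) ^ 2 with hN
  by_contra! hcon
  have hpow : ∀ i ∈ s, u ^ N ∉ I ⊔ span {w i} := fun i hi hmem ↦ by
    refine (hcon i hi).not_ge ?_
    calc (I ⊔ span {w i}).colength ≤ (I ⊔ span {u ^ N}).colength :=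
          colength_anti (sup_le le_sup_left ((span_singleton_le_iff_mem _).2 hmem))
      _ ≤ N * (I ⊔ span {u}).colength := colength_sup_span_pow_le I u N
      _ ≤ N * (a : ℕ∞) := by gcongr
      _ = (a * N : ℕ) := by push_cast; ring
  let J : ι → Ideal R := fun i ↦ I ⊔ span {w i} ⊔ span {u ^ (N + 1)}
  have hJ : ∀ i ∈ t, ((N + 1 : ℕ) : ℕ∞) ≤ (J i).colength := fun i hi ↦
    lt_colength_of_pow_notMem hu N _ fun hmem ↦ by
      simp only [J, pow_succ'] at hmem
      exact hpow i (hts hi) (mem_of_mem_sup_span_mul hu hmem)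
  have hJJ : ∀ i ∈ t, ∀ j ∈ t, i ≠ j → u ^ K ∈ J i ⊔ J j := fun i hi j hj hij ↦
    (sup_le (le_sup_of_le_left le_sup_left)
      (le_sup_of_le_right (le_sup_of_le_left le_sup_right)) :
        I ⊔ span {w i} ⊔ span {w j} ≤ J i ⊔ J j) (hw i (hts hi) j (hts hj) hij)
  have h₁ := mul_card_le_colength_inf I hI J
    (fun i ↦ le_sup_of_le_left le_sup_left) t hJ hJJ
  have h₂ : (t.inf J).colength ≤ ((N + 1) * a : ℕ) := by
    calc (t.inf J).colength ≤ (I ⊔ span {u ^ (N + 1)}).colength :=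
          colength_anti (Finset.le_inf fun i _ ↦ sup_le_sup_right le_sup_left _)
      _ ≤ (N + 1 : ℕ) * (I ⊔ span {u}).colength := colength_sup_span_pow_le I u _
      _ ≤ (N + 1 : ℕ) * (a : ℕ∞) := by gcongr
      _ = ((N + 1) * a : ℕ) := by push_cast; rfl
  have h₃ : (((N + 1) * (a + 1) : ℕ) : ℕ∞) ≤ ((N + 1) * a + N : ℕ) := by
    rw [ht] at h₁
    rw [Nat.cast_add]
    exact h₁.trans (by gcongr)
  have h₄ : (N + 1) * (a + 1) ≤ (N + 1) * a + N := by exact_mod_cast h₃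
  linarith

end Ideal

/-- A bound for the colength of a common parameter in terms of the colengths of two parameters. -/
def commonParameterBound (c : ℕ) : ℕ := c * (c * (2 * c + 1) * (c + 1) ^ 2)

namespace Ideal

variable {R : Type*} [CommRing R]

lemma isUnit_one_sub_pow_sub {v : R} (hv : v ∈ jacobson (⊥ : Ideal R)) {k l : ℕ} (hkl : k < l) :
    IsUnit (1 - v ^ (l - k)) := by
  have h : v ^ (l - k) ∈ jacobson (⊥ : Ideal R) :=
    Ideal.pow_mem_of_mem _ hv _ (Nat.sub_pos_of_lt hkl)
  simpa [sub_eq_add_neg, add_comm] using mem_jacobson_bot.1 h (-1)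

lemma mem_of_add_pow_mem {A : Ideal R} {u v : R} (hv : v ∈ jacobson (⊥ : Ideal R)) {k l : ℕ}
    (hkl : k ≠ l) (hk : u + v ^ k ∈ A) (hl : u + v ^ l ∈ A) : u ∈ A ∧ v ^ k ∈ A := by
  wlog hlt : k < l generalizing k l
  · have := this hkl.symm hl hk (by omega)
    exact ⟨this.1, by simpa using sub_mem hk this.1⟩
  have hpow : v ^ (l - k) * v ^ k = v ^ l := by rw [← pow_add, Nat.sub_add_cancel hlt.le]
  have hunit := isUnit_one_sub_pow_sub hv hlt
  have huA : u ∈ A := by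
    rw [← A.unit_mul_mem_iff_mem hunit]
    have : (1 - v ^ (l - k)) * u = (u + v ^ l) - v ^ (l - k) * (u + v ^ k) := by
      linear_combination hpow
    rw [this]
    exact sub_mem hl (A.mul_mem_left _ hk)
  exact ⟨huA, by simpa using sub_mem hk huA⟩

lemma exists_common_parameter {u v : R} (hu : u ∈ jacobson (⊥ : Ideal R))
    (hv : v ∈ jacobson (⊥ : Ideal R)) (I J : Ideal R) (c : ℕ)
    (hI : (I ⊔ span {u}).colength ≤ c) (hJ : (J ⊔ span {v}).colength ≤ c) :
    ∃ w ∈ jacobson (⊥ : Ideal R), (I ⊔ span {w}).colength ≤ commonParameterBound c ∧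
      (J ⊔ span {w}).colength ≤ commonParameterBound c := by
  classical
  let w : ℕ → R := fun k ↦ u + v ^ k
  let T := Finset.Icc 1 (2 * c + 1)
  have hT : T.card = 2 * c + 1 := by simp [T]
  have hkey : ∀ (A : Ideal R), ∀ i ∈ T, ∀ j ∈ T, i ≠ j →
      u ^ (2 * c + 1) ∈ A ⊔ span {w i} ⊔ span {w j} ∧
      v ^ (2 * c + 1) ∈ A ⊔ span {w i} ⊔ span {w j} := fun A i hi j _ hij ↦ by
    have h := mem_of_add_pow_mem (A := A ⊔ span {w i} ⊔ span {w j}) (u := u) hv hij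
      (mem_sup_left (mem_sup_right (mem_span_singleton_self _)))
      (mem_sup_right (mem_span_singleton_self _))
    exact ⟨pow_mem_of_mem _ h.1 _ (by omega),
      mem_of_dvd _ (pow_dvd_pow v (Finset.mem_Icc.1 hi).2) h.2⟩
  let B : Ideal R → Finset ℕ := fun A ↦
    T.filter fun k ↦ ¬ (A ⊔ span {w k}).colength ≤ commonParameterBound c
  have hBT : ∀ A, B A ⊆ T := fun A ↦ Finset.filter_subset _ _
  have hB : ∀ (A : Ideal R) (z : R), z ∈ jacobson (⊥ : Ideal R) →
      (A ⊔ span {z}).colength ≤ c → (∀ i ∈ T, ∀ j ∈ T, i ≠ j →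
        z ^ (2 * c + 1) ∈ A ⊔ span {w i} ⊔ span {w j}) → (B A).card ≤ c := by
    intro A z hz hA hzw
    by_contra! hcard
    obtain ⟨i, hi, hle⟩ := exists_colength_sup_span_le hz A hA w (B A) hcard
      fun i hi j hj ↦ hzw i (hBT A hi) j (hBT A hj)
    exact (Finset.mem_filter.1 hi).2 hle
  have hBI := hB I u hu hI fun i hi j hj hij ↦ (hkey I i hi j hj hij).1
  have hBJ := hB J v hv hJ fun i hi j hj hij ↦ (hkey J i hi j hj hij).2
  obtain ⟨k, hkT, hk⟩ : ∃ k ∈ T, k ∉ B I ∪ B J := by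
    refine Finset.exists_mem_notMem_of_card_lt_card ?_
    have := Finset.card_union_le (B I) (B J)
    omega
  rw [Finset.mem_union, not_or] at hk
  simp only [B, Finset.mem_filter, hkT, true_and, not_not] at hk
  exact ⟨w k, add_mem hu (pow_mem_of_mem _ hv _ (Finset.mem_Icc.1 hkT).1), hk⟩

lemma exists_common_parameters (n : ℕ) (I J : Ideal R) (c : ℕ) (u v : Fin n → R)
    (hu : ∀ i, u i ∈ jacobson (⊥ : Ideal R)) (hv : ∀ i, v i ∈ jacobson (⊥ : Ideal R))
    (hI : (I ⊔ span (Set.range u)).colength ≤ c)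
    (hJ : (J ⊔ span (Set.range v)).colength ≤ c) :
    ∃ w : Fin n → R, (∀ i, w i ∈ jacobson (⊥ : Ideal R)) ∧
      (I ⊔ span (Set.range w)).colength ≤ commonParameterBound^[n] c ∧
      (J ⊔ span (Set.range w)).colength ≤ commonParameterBound^[n] c := by
  induction n generalizing I J c with
  | zero =>
    refine ⟨u, hu, hI, ?_⟩
    rwa [Subsingleton.elim u v]
  | succ n ih =>
    have hsplit : ∀ (A : Ideal R) (z : R) (t : Fin n → R),
        A ⊔ span (Set.range (Fin.cons z t : Fin (n + 1) → R)) =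
          A ⊔ span {z} ⊔ span (Set.range t) := fun A z t ↦ by
      rw [Fin.range_cons, span_insert, sup_assoc]
    rw [← Fin.cons_self_tail u, hsplit, sup_right_comm] at hI
    rw [← Fin.cons_self_tail v, hsplit, sup_right_comm] at hJ
    obtain ⟨z, hz, hzI, hzJ⟩ := exists_common_parameter (hu 0) (hv 0) _ _ c hI hJ
    rw [sup_right_comm] at hzI hzJ
    obtain ⟨w, hw, hwI, hwJ⟩ := ih (I ⊔ span {z}) (J ⊔ span {z}) (commonParameterBound c)
      (Fin.tail u) (Fin.tail v) (fun i ↦ hu i.succ) (fun i ↦ hv i.succ) hzI hzJ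
    refine ⟨Fin.cons z w, Fin.cases hz hw, ?_⟩
    rw [hsplit, hsplit, Function.iterate_succ_apply]
    exact ⟨hwI, hwJ⟩

end Ideal

lemma le_embdim_of_ringKrullDim_eq {R : Type u} [CommRing R] [IsLocalRing R] [IsNoetherianRing R]
    {d : ℕ} (hd : ringKrullDim R = (d : WithBot ℕ∞)) : d ≤ embdim R := by
  have hne : {c : ℕ | ∃ s : Finset R, s.card = c ∧
      Ideal.span (s : Set R) = IsLocalRing.maximalIdeal R}.Nonempty := by
    obtain ⟨s, hs⟩ := (IsLocalRing.maximalIdeal R).fg_of_isNoetherianRing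
    exact ⟨s.card, s, rfl, hs⟩
  obtain ⟨s, hcard, hs⟩ := Nat.sInf_mem hne
  have h := ringKrullDim_le_spanFinrank_maximalIdeal (R := R)
  rw [hd, ← hs] at h
  have hle := Submodule.spanFinrank_span_le_ncard_of_finite (R := R) s.finite_toSet
  rw [Set.ncard_coe_finset, hcard] at hle
  have h' : d ≤ (Ideal.span (s : Set R)).spanFinrank := by exact_mod_cast h
  exact h'.trans hle

lemma modLength_quotient_span {R : Type u} [CommRing R] {n : ℕ} (x : R) (y : Fin n → R) :
    modLength R (R ⧸ Ideal.span ({x} ∪ Set.range y)) =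
      ((Ideal.span {x} ⊔ Ideal.span (Set.range y)).colength : WithBot ℕ∞) := by
  rw [← Ideal.span_union, Ideal.colength, Module.coe_length, modLength]

lemma exists_colength_le_of_rdeg_eq {R : Type u} [CommRing R] [IsLocalRing R] {d a : ℕ} {x : R}
    (hx : ¬ IsUnit x) (h : rdeg R d x = (a : WithBot ℕ∞)) :
    ∃ y : Fin (d - 1) → R, (∀ i, y i ∈ IsLocalRing.maximalIdeal R) ∧
      (Ideal.span {x} ⊔ Ideal.span (Set.range y)).colength ≤ a := by
  rw [rdeg, if_neg hx] at h
  have hlt : (a : WithBot ℕ∞) < ((a + 1 : ℕ) : WithBot ℕ∞) := by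
    exact_mod_cast Nat.lt_succ_self a
  rw [← h, iInf_lt_iff] at hlt
  obtain ⟨y, hy⟩ := hlt
  refine ⟨y.1, y.2, ?_⟩
  rw [modLength_quotient_span] at hy
  have hy' : (Ideal.span {x} ⊔ Ideal.span (Set.range y.1)).colength < ((a + 1 : ℕ) : ℕ∞) := by
    exact_mod_cast hy
  rw [Nat.cast_succ] at hy'
  exact Order.le_of_lt_add_one hy'

lemma rdeg_mul_of_isUnit {R : Type u} [CommRing R] [IsLocalRing R] (d : ℕ) {x : R} (y : R)
    (hx : IsUnit x) : rdeg R d (x * y) = rdeg R d y := by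
  have hspan : Ideal.span {x * y} = Ideal.span {y} := Ideal.span_singleton_mul_left_unit hx y
  by_cases hy : IsUnit y
  · rw [rdeg, rdeg, if_pos (hx.mul hy), if_pos hy]
  · rw [rdeg, rdeg, if_neg fun h ↦ hy (isUnit_of_mul_isUnit_right h), if_neg hy]
    simp only [modLength_quotient_span, hspan]

theorem degree_of_product_uniformly_bounded :
    ∃ ω : ℕ → ℕ → ℕ → ℕ,
      ∀ (R : Type u) [CommRing R] [IsLocalRing R] [IsNoetherianRing R] (d : ℕ),
        1 ≤ d → ringKrullDim R = (d : WithBot ℕ∞) →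
        ∀ (x y : R) (a b : ℕ),
          rdeg R d x = (a : WithBot ℕ∞) → rdeg R d y = (b : WithBot ℕ∞) →
          rdeg R d (x * y) ≤ (ω (embdim R) a b : WithBot ℕ∞) := by
  refine ⟨fun e a b ↦ a + b + ∑ n ∈ Finset.range (e + 1),
    2 * commonParameterBound^[n] (max a b), ?_⟩
  intro R _ _ _ d _ hdim x y a b hx hy
  beta_reduce
  by_cases hxu : IsUnit x
  · rw [rdeg_mul_of_isUnit d y hxu, hy]
    exact_mod_cast (Nat.le_add_left b a).trans (Nat.le_add_right (a + b) _)
  by_cases hyu : IsUnit y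
  · rw [mul_comm, rdeg_mul_of_isUnit d x hyu, hx]
    exact_mod_cast (Nat.le_add_right a b).trans (Nat.le_add_right (a + b) _)
  obtain ⟨u, hu, hul⟩ := exists_colength_le_of_rdeg_eq hxu hx
  obtain ⟨v, hv, hvl⟩ := exists_colength_le_of_rdeg_eq hyu hy
  have hjac : Ideal.jacobson (⊥ : Ideal R) = IsLocalRing.maximalIdeal R :=
    IsLocalRing.jacobson_eq_maximalIdeal ⊥ bot_ne_top
  simp only [← hjac] at hu hv
  obtain ⟨w, hw, hwx, hwy⟩ := Ideal.exists_common_parameters (d - 1) _ _ (max a b) u v hu hv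
    (hul.trans (by exact_mod_cast le_max_left a b)) (hvl.trans (by exact_mod_cast le_max_right a b))
  simp only [hjac] at hw
  have hxyu : ¬ IsUnit (x * y) := fun h ↦ hxu (isUnit_of_mul_isUnit_left h)
  have hcol : (Ideal.span {x * y} ⊔ Ideal.span (Set.range w)).colength ≤
      (2 * commonParameterBound^[d - 1] (max a b) : ℕ) := by
    rw [sup_comm] at hwx hwy ⊢
    refine (Ideal.colength_sup_span_mul_le _ x y).trans ((add_le_add hwx hwy).trans_eq ?_)
    rw [two_mul, Nat.cast_add]
  have hd := le_embdim_of_ringKrullDim_eq hdim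
  have hsum : 2 * commonParameterBound^[d - 1] (max a b) ≤ ∑ n ∈ Finset.range (embdim R + 1),
      2 * commonParameterBound^[n] (max a b) :=
    Finset.single_le_sum (f := fun n ↦ 2 * commonParameterBound^[n] (max a b))
      (fun _ _ ↦ Nat.zero_le _) (Finset.mem_range.2 (by omega))
  rw [rdeg, if_neg hxyu]
  refine (iInf_le _ ⟨w, hw⟩).trans ?_
  rw [modLength_quotient_span]
  have hfin := hcol.trans (Nat.cast_le.2 (hsum.trans (Nat.le_add_left _ (a + b))))
  exact WithBot.coe_le_coe.2 hfin
end

section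
/- There exists a function π : ℕ² → ℕ with the following property. Let (R, m) be any Noetherian local ring of Krull dimension d ≥ 1 and let x ∈ R have finite degree deg(x). Then the m-adic order of x satisfies ord(x) ≤ π(e, deg(x)), where e is the embedding dimension of R. -/
/-!
STATEMENT 16: There is a function `π : ℕ² → ℕ` such that for every Noetherian local ring
`(R, m)` of Krull dimension `d ≥ 1` and every `x ∈ R` of finite degree,
`ord(x) ≤ π(e, deg x)` where `e` is the embedding dimension of `R`.
Here `deg(x)` is `0` for a unit, and otherwise the least length of
`R/(xR + (y₁, …, y_{d−1})R)` over all `(d−1)`-tuples of elements of `m`; `ord x` is the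
largest `n` with `x ∈ m^n`.
-/

universe u

/-- The `m`-adic order of an element of a local ring (junk value for elements of
infinite order, e.g. `0`). -/
noncomputable def ordR (R : Type u) [CommRing R] [IsLocalRing R] (x : R) : ℕ :=
  sSup {n : ℕ | x ∈ IsLocalRing.maximalIdeal R ^ n}

open IsLocalRing in
/-- In a Noetherian local ring, a finite module whose submodule lattice has no chain of length
greater than `a` is annihilated by the `a`-th power of the maximal ideal. -/
theorem maximalIdeal_pow_smul_top_eq_bot_of_krullDim_lt {R M : Type*} [CommRing R] [IsLocalRing R]
    [IsNoetherianRing R] [AddCommGroup M] [Module R M] [Module.Finite R M] {a : ℕ}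
    (h : Order.krullDim (Submodule R M) < ((a + 1 : ℕ) : WithBot ℕ∞)) :
    maximalIdeal R ^ a • (⊤ : Submodule R M) = ⊥ := by
  by_contra hne
  let f : Fin (a + 2) → Submodule R M := fun i => maximalIdeal R ^ (i.rev : ℕ) • ⊤
  have hstep (i : Fin (a + 1)) : f i.castSucc < f i.succ := by
    have hrev : (i.castSucc.rev : ℕ) = (i.succ.rev : ℕ) + 1 := by
      simp only [Fin.val_rev, Fin.val_castSucc, Fin.val_succ]
      omega
    have hle : (i.succ.rev : ℕ) ≤ a := by
      simp only [Fin.val_rev, Fin.val_succ]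
      omega
    simp only [f, hrev, pow_succ', Submodule.mul_smul]
    refine lt_of_le_not_ge Submodule.smul_le_right fun hge => hne ?_
    have hbot := Submodule.eq_bot_of_le_smul_of_le_jacobson_bot _ _
      (IsNoetherian.noetherian _) hge (maximalIdeal_le_jacobson ⊥)
    exact le_bot_iff.mp ((Submodule.smul_mono_left (Ideal.pow_le_pow_right hle)).trans hbot.le)
  exact h.not_ge (Order.LTSeries.length_le_krullDim ⟨a + 1, f, hstep⟩)

open IsLocalRing in
/-- The Krull dimension of a Noetherian local ring is at most the number of generators of any
ideal that is primary to the maximal ideal. -/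
theorem ringKrullDim_le_of_maximalIdeal_pow_le_span {R : Type*} [CommRing R] [IsLocalRing R]
    [IsNoetherianRing R] {k a : ℕ} {y : Fin k → R} (hy : ∀ i, y i ∈ maximalIdeal R)
    (h : maximalIdeal R ^ a ≤ Ideal.span (Set.range y)) : ringKrullDim R ≤ k := by
  have hmin : maximalIdeal R ∈ (Ideal.span (Set.range y)).minimalPrimes := by
    refine ⟨⟨inferInstance, Ideal.span_le.mpr (Set.range_subset_iff.mpr hy)⟩, ?_⟩
    rintro p ⟨hp, hle⟩ -
    exact hp.le_of_pow_le (h.trans hle)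
  have hcard : (Set.range y).ncard ≤ k := by
    rw [← Set.image_univ]
    exact (Set.ncard_image_le Set.finite_univ).trans (by simp)
  rw [← maximalIdeal_height_eq_ringKrullDim]
  have := (Ideal.height_le_card_of_mem_minimalPrimes_span (Set.finite_range y) hmin).trans
    (Nat.cast_le.mpr hcard)
  exact_mod_cast this

open IsLocalRing in
/-- If a power of the maximal ideal lies in `xR + I` and `x` lies in the next power, then it
already lies in `I`. -/
theorem maximalIdeal_pow_le_of_le_span_singleton_sup {R : Type*} [CommRing R] [IsLocalRing R]
    [IsNoetherianRing R] {a : ℕ} {x : R} {I : Ideal R} (hx : x ∈ maximalIdeal R ^ (a + 1))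
    (h : maximalIdeal R ^ a ≤ Ideal.span {x} ⊔ I) : maximalIdeal R ^ a ≤ I := by
  refine Submodule.le_of_le_smul_of_le_jacobson_bot (IsNoetherian.noetherian _)
    (maximalIdeal_le_jacobson ⊥) (h.trans (sup_le ?_ le_sup_left))
  rw [smul_eq_mul, ← pow_succ', Ideal.span_singleton_le_iff_mem]
  exact Ideal.mem_sup_right hx

theorem order_bounded_by_degree :
    ∃ π : ℕ → ℕ → ℕ,
      ∀ (R : Type u) [CommRing R] [IsLocalRing R] [IsNoetherianRing R] (d : ℕ),
        1 ≤ d → ringKrullDim R = (d : WithBot ℕ∞) →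
        ∀ (x : R) (a : ℕ), rdeg R d x = (a : WithBot ℕ∞) →
          ordR R x ≤ π (embdim R) a := by
  refine ⟨fun _ a => a, fun R _ _ _ d hd hdim x a ha => csSup_le' fun n hn => ?_⟩
  by_contra! hlt
  have hx : x ∈ IsLocalRing.maximalIdeal R ^ (a + 1) := Ideal.pow_le_pow_right hlt hn
  have hunit : ¬ IsUnit x :=
    (IsLocalRing.mem_maximalIdeal x).mp (Ideal.pow_le_self a.succ_ne_zero hx)
  rw [rdeg, if_neg hunit] at ha
  have : Nonempty {y : Fin (d - 1) → R // ∀ i, y i ∈ IsLocalRing.maximalIdeal R} :=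
    ⟨⟨0, fun _ => zero_mem _⟩⟩
  obtain ⟨⟨y, hy⟩, hlen⟩ := exists_lt_of_ciInf_lt
    (ha.trans_lt (show (a : WithBot ℕ∞) < ((a + 1 : ℕ) : WithBot ℕ∞) by
      exact_mod_cast a.lt_succ_self))
  have hann := maximalIdeal_pow_smul_top_eq_bot_of_krullDim_lt hlen
  have hle : IsLocalRing.maximalIdeal R ^ a ≤ Ideal.span {x} ⊔ Ideal.span (Set.range y) := by
    rw [← Ideal.span_union]
    intro r hr
    rw [← Ideal.Quotient.eq_zero_iff_mem, ← Submodule.mem_bot R, ← hann]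
    rw [← mul_one r, ← smul_eq_mul, ← Ideal.Quotient.mk_eq_mk, Submodule.Quotient.mk_smul]
    exact Submodule.smul_mem_smul hr
      Submodule.mem_top
  have hdle := ringKrullDim_le_of_maximalIdeal_pow_le_span hy
    (maximalIdeal_pow_le_of_le_span_singleton_sup hx hle)
  rw [hdim] at hdle
  have : d ≤ d - 1 := by exact_mod_cast hdle
  omega
end

section
/- Let (R, m) be a Noetherian local ring of Krull dimension d ≥ 1. Then R is unmixed (i.e., every associated prime P of the zero ideal of the m-adic completion R̂ satisfies dim(R̂/P) = d) if and only if there exists a function χ : ℕ × ℕ → ℕ such that for all x, y ∈ R with deg(x) finite and y nonzero, ord(xy) ≤ χ(deg(x), ord(y)). -/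
/-!
STATEMENT 17: A Noetherian local ring `(R, m)` of Krull dimension `d ≥ 1` is unmixed
(every associated prime `P` of the zero ideal of the completion `R̂` satisfies
`dim (R̂/P) = d`) iff there is a function `χ : ℕ × ℕ → ℕ` such that for all `x, y ∈ R`
with `deg x` finite and `y ≠ 0`, `ord(xy) ≤ χ(deg x, ord y)` (in particular `xy ≠ 0`).
-/

universe u

open IsLocalRing

namespace AdicCompletion

/-- The adic completion of a Noetherian ring is Noetherian. -/
theorem isNoetherianRing_of_isNoetherianRing {R : Type*} [CommRing R] [IsNoetherianRing R]
    (I : Ideal R) : IsNoetherianRing (AdicCompletion I R) := by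
  obtain ⟨n, g, hg⟩ := Submodule.fg_iff_exists_fin_generating_family.mp
    (IsNoetherian.noetherian I)
  have hg : Ideal.span (Set.range g) = I := hg
  let J := MvPolynomial.idealOfVars (Fin n) R
  let φ : MvPolynomial (Fin n) R →+* R := (MvPolynomial.aeval g : _ →ₐ[R] R).toRingHom
  have hφC : ∀ r, φ (MvPolynomial.C r) = r := fun r => by simp [φ]
  have hJ : J.map φ = I := by
    rw [← hg]
    simp only [J, MvPolynomial.idealOfVars, Ideal.map_span, ← Set.range_comp]
    congr 2
    ext i
    simp [φ]
  have hle : ∀ k, J ^ k ≤ (I ^ k).comap φ := fun k => by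
    rw [← Ideal.map_le_iff_le_comap, Ideal.map_pow, hJ]
  let F : AdicCompletion J (MvPolynomial (Fin n) R) →+* AdicCompletion I R :=
    AdicCompletion.liftRingHom I
      (fun k => (Ideal.quotientMap (I ^ k) φ (hle k)).comp (evalₐ J k).toRingHom) (by
        intro a b hab
        ext x
        induction x using AdicCompletion.induction_on with
        | _ x =>
          have h : Ideal.Quotient.mk (J ^ a) (x b) = Ideal.Quotient.mk (J ^ a) (x a) :=
            Ideal.mk_eq_mk J hab x
          have h' := congrArg (Ideal.quotientMap (I ^ a) φ (hle a)) h
          simpa using h')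
  have hF : ∀ p, F (of J _ p) = of I R (φ p) := by
    intro p
    apply ext_evalₐ
    intro k
    exact (evalₐ_liftRingHom I _ _ k _).trans (by simp)
  have : IsNoetherianRing (AdicCompletion J (MvPolynomial (Fin n) R)) :=
    isNoetherianRing_of_ringEquiv (MvPowerSeries (Fin n) R)
      (MvPowerSeries.toAdicCompletionAlgEquiv (Fin n) R).toRingEquiv
  refine isNoetherianRing_of_surjective _ _ F ?_
  have hJfg : J.FG := IsNoetherian.noetherian J
  have hIfg : I.FG := IsNoetherian.noetherian I
  have c1 := isAdicComplete_self J hJfg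
  have c2 := isAdicComplete_self I hIfg
  have hmap : (J.map (algebraMap _ (AdicCompletion J (MvPolynomial (Fin n) R)))).map F =
      I.map (algebraMap R (AdicCompletion I R)) := by
    have : Ideal.map (algebraMap R (AdicCompletion I R)) I =
        (J.map φ).map (algebraMap R (AdicCompletion I R)) := by rw [hJ]
    rw [this, Ideal.map_map, Ideal.map_map]
    congr 1
  have : IsHausdorff ((J.map (algebraMap _
      (AdicCompletion J (MvPolynomial (Fin n) R)))).map F) (AdicCompletion I R) := by
    rw [hmap]; infer_instance
  refine surjective_of_mk_map_comp_surjective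
    (I := J.map (algebraMap _ (AdicCompletion J (MvPolynomial (Fin n) R)))) F ?_
  intro y
  obtain ⟨y, rfl⟩ := Ideal.Quotient.mk_surjective y
  obtain ⟨r, hr⟩ := Ideal.Quotient.mk_surjective (evalOneₐ I y)
  refine ⟨of J _ (MvPolynomial.C r), ?_⟩
  rw [RingHom.comp_apply, Ideal.Quotient.eq, hmap, ← ker_evalOneₐ_eq_map I hIfg, hF, hφC]
  simp [RingHom.mem_ker, ← hr]

end AdicCompletion

/-- A linear form of the Artin-Rees lemma. -/
theorem LinearMap.exists_artinRees {S M N : Type*} [CommRing S] [IsNoetherianRing S]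
    [AddCommGroup M] [Module S M] [AddCommGroup N] [Module S N] [Module.Finite S N]
    (I : Ideal S) (f : M →ₗ[S] N) :
    ∃ κ : ℕ, ∀ (n : ℕ) (y : M), f y ∈ I ^ (n + κ) • (⊤ : Submodule S N) →
      ∃ z ∈ I ^ n • (⊤ : Submodule S M), f z = f y := by
  obtain ⟨κ, hκ⟩ := I.exists_pow_inf_eq_pow_smul (LinearMap.range f)
  refine ⟨κ, fun n y hy => ?_⟩
  have h := hκ (n + κ) (by omega)
  have h2 : f y ∈ I ^ (n + κ - κ) • (I ^ κ • ⊤ ⊓ LinearMap.range f) := by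
    rw [← h]; exact ⟨hy, y, rfl⟩
  rw [Nat.add_sub_cancel] at h2
  have h3 : f y ∈ I ^ n • LinearMap.range f := Submodule.smul_mono le_rfl inf_le_right h2
  rw [LinearMap.range_eq_map, ← Submodule.map_smul''] at h3
  obtain ⟨z, hz, hzy⟩ := h3
  exact ⟨z, hz, hzy⟩

theorem IsPrecomplete.of_finite {S M : Type*} [CommRing S] [AddCommGroup M] [Module S M]
    [Module.Finite S M] (I : Ideal S) [IsPrecomplete I S] : IsPrecomplete I M := by
  rw [← AdicCompletion.of_surjective_iff]
  intro x
  obtain ⟨w, rfl⟩ := AdicCompletion.ofTensorProduct_surjective_of_finite I M x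
  induction w using TensorProduct.induction_on with
  | zero => exact ⟨0, by simp⟩
  | tmul r m =>
    obtain ⟨s, rfl⟩ := AdicCompletion.of_surjective I S r
    refine ⟨s • m, ?_⟩
    rw [AdicCompletion.ofTensorProduct_tmul]
    simp only [map_smul]
    change _ = algebraMap S (AdicCompletion I S) s • _
    rw [algebraMap_smul]
  | add a b ha hb =>
    obtain ⟨u, hu⟩ := ha
    obtain ⟨v, hv⟩ := hb
    exact ⟨u + v, by simp [hu, hv]⟩

theorem isArtinianRing_quotient_of_pow_le {S : Type*} [CommRing S] [IsLocalRing S]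
    [IsNoetherianRing S] {J : Ideal S} {n : ℕ} (h : maximalIdeal S ^ n ≤ J) :
    IsArtinianRing (S ⧸ J) := by
  by_cases hJ : J = ⊤
  · have : Subsingleton (S ⧸ J) := Ideal.Quotient.subsingleton_iff.mpr hJ
    infer_instance
  refine IsLocalRing.quotient_artinian_of_mem_minimalPrimes_of_isLocalRing J
    ⟨⟨inferInstance, le_maximalIdeal hJ⟩, fun Q hQ _ => hQ.1.le_of_pow_le (h.trans hQ.2)⟩

theorem isArtinian_quotient_pow_smul_top {S M : Type*} [CommRing S] [IsLocalRing S]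
    [IsNoetherianRing S] [AddCommGroup M] [Module S M] [Module.Finite S M] (n : ℕ) :
    IsArtinian S (M ⧸ (maximalIdeal S ^ n • ⊤ : Submodule S M)) := by
  have : IsArtinianRing (S ⧸ maximalIdeal S ^ n) := isArtinianRing_quotient_of_pow_le le_rfl
  have : IsScalarTower S (S ⧸ maximalIdeal S ^ n) (M ⧸ (maximalIdeal S ^ n • ⊤ : Submodule S M)) :=
    (Module.isTorsionBySet_quotient_ideal_smul M (maximalIdeal S ^ n)).isScalarTower
  have : Module.Finite (S ⧸ maximalIdeal S ^ n) (M ⧸ (maximalIdeal S ^ n • ⊤ : Submodule S M)) :=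
    Module.Finite.of_restrictScalars_finite S _ _
  have : IsArtinian (S ⧸ maximalIdeal S ^ n) (M ⧸ (maximalIdeal S ^ n • ⊤ : Submodule S M)) :=
    inferInstance
  exact isArtinian_of_surjective_algebraMap (R := S ⧸ maximalIdeal S ^ n)
    Ideal.Quotient.mk_surjective

/-- Chevalley's theorem: in a finite module over a complete Noetherian local ring, a decreasing
sequence of submodules with zero intersection is cofinal with the adic filtration. -/
theorem exists_le_pow_smul_top_of_iInf_eq_bot {S M : Type*} [CommRing S] [IsLocalRing S]
    [IsNoetherianRing S] [IsAdicComplete (maximalIdeal S) S] [AddCommGroup M] [Module S M]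
    [Module.Finite S M] (L : ℕ → Submodule S M) (hL : Antitone L) (hinf : ⨅ b, L b = ⊥) (n : ℕ) :
    ∃ b, L b ≤ maximalIdeal S ^ n • ⊤ := by
  by_contra! hcon
  set F : ℕ → Submodule S M := fun k => maximalIdeal S ^ k • ⊤ with hF
  have hFanti : Antitone F := fun i j hij => Submodule.smul_mono_left (Ideal.pow_le_pow_right hij)
  have hstab : ∀ k, ∃ b, ∀ c ≥ b, L b ⊔ F k ≤ L c ⊔ F k := by
    intro k
    have := isArtinian_quotient_pow_smul_top (S := S) (M := M) k
    obtain ⟨b, hb⟩ := IsArtinian.monotone_stabilizes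
      (R := S) (M := M ⧸ F k)
      ⟨fun b => OrderDual.toDual ((L b).map (F k).mkQ), fun i j hij => Submodule.map_mono (hL hij)⟩
    refine ⟨b, fun c hc => ?_⟩
    have h := congrArg (Submodule.comap (F k).mkQ) (congrArg OrderDual.ofDual (hb c hc))
    change Submodule.comap (F k).mkQ ((L b).map (F k).mkQ) =
      Submodule.comap (F k).mkQ ((L c).map (F k).mkQ) at h
    rw [Submodule.comap_map_mkQ, Submodule.comap_map_mkQ, sup_comm, sup_comm (F k)] at h
    exact h.le
  choose β hβ using hstab
  set V : ℕ → Submodule S M := fun k => ⨅ b, L b ⊔ F k with hV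
  have hVeq : ∀ k c, β k ≤ c → V k = L c ⊔ F k := by
    intro k c hc
    refine le_antisymm (iInf_le _ _) (le_iInf fun b => ?_)
    rcases le_total b (β k) with h | h
    · exact sup_le_sup_right (hL (h.trans hc)) _
    · exact (sup_le_sup_right (hL hc) _).trans (hβ k b h)
  have hstep : ∀ k, ∀ v ∈ V k, ∃ w ∈ V (k + 1), v - w ∈ F k := by
    intro k v hv
    rw [hVeq k (max (β k) (β (k + 1))) (le_max_left _ _)] at hv
    obtain ⟨w, hw, u, hu, rfl⟩ := Submodule.mem_sup.mp hv
    refine ⟨w, ?_, by simpa using hu⟩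
    rw [hVeq (k + 1) (max (β k) (β (k + 1))) (le_max_right _ _)]
    exact Submodule.mem_sup_left hw
  obtain ⟨v0, hv0, hv0n⟩ := SetLike.not_le_iff_exists.mp (hcon (β n))
  choose! next hnext hnext' using hstep
  let v : ℕ → M := fun k => Nat.rec v0 (fun i w => next (n + i) w) k
  have hvV : ∀ k, v k ∈ V (n + k) := by
    intro k
    induction k with
    | zero =>
      rw [add_zero, hVeq n (β n) le_rfl]
      exact Submodule.mem_sup_left hv0
    | succ k ih => exact hnext (n + k) _ ih
  have hsub : ∀ k j, v k - v (k + j) ∈ F (n + k) := by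
    intro k j
    induction j with
    | zero => simp
    | succ j ih =>
      have h := hnext' (n + (k + j)) (v (k + j)) (hvV _)
      have h2 := add_mem ih (hFanti (by omega : n + k ≤ n + (k + j)) h)
      have h3 : v (k + (j + 1)) = next (n + (k + j)) (v (k + j)) := rfl
      rwa [← h3, sub_add_sub_cancel] at h2
  have := IsPrecomplete.of_finite (M := M) (maximalIdeal S)
  obtain ⟨w, hw⟩ := IsPrecomplete.prec (I := maximalIdeal S) (M := M) inferInstance (f := v) (by
    intro i j hij
    obtain ⟨l, rfl⟩ := Nat.exists_eq_add_of_le hij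
    rw [SModEq.sub_mem]
    exact hFanti (by omega : i ≤ n + i) (hsub i l))
  have hw : ∀ k, v k - w ∈ F k := fun k => SModEq.sub_mem.mp (hw k)
  have hwL : ∀ b k, w ∈ L b ⊔ F k := by
    intro b k
    have h1 : v k ∈ L b ⊔ F k :=
      sup_le_sup_left (hFanti (by omega : k ≤ n + k)) _ ((iInf_le _ b : V (n + k) ≤ _) (hvV k))
    have := sub_mem h1 (Submodule.mem_sup_right (hw k) : _ ∈ L b ⊔ F k)
    simpa using this
  have hwmem : ∀ b, w ∈ L b := by
    intro b
    have hH : IsHausdorff (maximalIdeal S) (M ⧸ L b) := inferInstance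
    rw [← Submodule.Quotient.mk_eq_zero]
    refine hH.haus _ fun k => ?_
    rw [SModEq.zero]
    have h := Submodule.mem_map_of_mem (f := (L b).mkQ) (hwL b k)
    rw [Submodule.map_sup] at h
    simpa [hF, Submodule.map_smul''] using h
  have hw0 : w = 0 := by
    have : w ∈ ⨅ b, L b := by simpa using hwmem
    simpa [hinf] using this
  apply hv0n
  have h1 := hw n
  have h2 := hFanti (by omega : n ≤ n + 0) (hsub 0 n)
  rw [hw0, sub_zero] at h1
  have h3 := add_mem h2 h1
  simpa [v] using h3

section Length

variable {S : Type*} [CommRing S]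

theorem length_quotient_anti {I J : Ideal S} (h : I ≤ J) :
    Module.length S (S ⧸ J) ≤ Module.length S (S ⧸ I) :=
  Module.length_le_of_surjective (Submodule.factor h) (Submodule.factor_surjective h)

theorem length_quotient_add_one_le {I J : Ideal S} (h : I < J) :
    Module.length S (S ⧸ J) + 1 ≤ Module.length S (S ⧸ I) := by
  rw [Module.length_quotient, Module.length_quotient]
  exact Order.coheight_add_one_le h

theorem length_quotient_add_length_quotient_le (I J : Ideal S) :
    Module.length S (S ⧸ I) + Module.length S (S ⧸ J) ≤
      Module.length S (S ⧸ (I ⊓ J)) + Module.length S (S ⧸ (I ⊔ J)) := by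
  rw [← Module.length_prod]
  refine (Module.length_eq_add_of_exact
    ((Submodule.factor (inf_le_left : I ⊓ J ≤ I)).prod (Submodule.factor (inf_le_right : I ⊓ J ≤ J)))
    ((Submodule.factor (le_sup_left : I ≤ I ⊔ J)).coprod
      (-Submodule.factor (le_sup_right : J ≤ I ⊔ J))) ?_ ?_ ?_).le
  · rw [injective_iff_map_eq_zero]
    intro a
    obtain ⟨a, rfl⟩ := Submodule.Quotient.mk_surjective _ a
    intro h
    have h1 := congrArg Prod.fst h
    have h2 := congrArg Prod.snd h
    change Submodule.Quotient.mk a = 0 at h1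
    change Submodule.Quotient.mk a = 0 at h2
    rw [Submodule.Quotient.mk_eq_zero] at h1 h2 ⊢
    exact ⟨h1, h2⟩
  · intro b
    obtain ⟨b, rfl⟩ := Submodule.Quotient.mk_surjective _ b
    refine ⟨(Submodule.Quotient.mk b, Submodule.Quotient.mk 0), ?_⟩
    change (Submodule.Quotient.mk b + -Submodule.Quotient.mk 0 : S ⧸ (I ⊔ J)) = _
    simp
  · rintro ⟨a, b⟩
    obtain ⟨a, rfl⟩ := Submodule.Quotient.mk_surjective _ a
    obtain ⟨b, rfl⟩ := Submodule.Quotient.mk_surjective _ b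
    constructor
    · intro h
      have h' : (Submodule.Quotient.mk a + -Submodule.Quotient.mk b : S ⧸ (I ⊔ J)) = 0 := h
      rw [← Submodule.Quotient.mk_neg, ← Submodule.Quotient.mk_add,
        Submodule.Quotient.mk_eq_zero] at h'
      obtain ⟨i, hi, j, hj, hij⟩ := Submodule.mem_sup.mp h'
      refine ⟨Submodule.Quotient.mk (a - i), Prod.ext ?_ ?_⟩
      · change Submodule.Quotient.mk (a - i) = Submodule.Quotient.mk a
        rw [Submodule.Quotient.eq]; simpa using hi
      · change Submodule.Quotient.mk (a - i) = Submodule.Quotient.mk b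
        rw [Submodule.Quotient.eq]
        convert hj using 1
        linear_combination -hij
    · rintro ⟨c, hc⟩
      obtain ⟨c, rfl⟩ := Submodule.Quotient.mk_surjective _ c
      rw [← hc]
      change (Submodule.Quotient.mk c + -Submodule.Quotient.mk c : S ⧸ (I ⊔ J)) = 0
      simp

theorem length_quotient_sup_span_pow_le (I : Ideal S) (y : S) (n : ℕ) :
    Module.length S (S ⧸ (I ⊔ Ideal.span {y ^ n})) ≤
      n * Module.length S (S ⧸ (I ⊔ Ideal.span {y})) := by
  induction n with
  | zero => simp
  | succ n ih =>
    have hle : I ⊔ Ideal.span {y ^ (n + 1)} ≤ I ⊔ Ideal.span {y ^ n} :=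
      sup_le_sup_left (Ideal.span_singleton_le_span_singleton.mpr (pow_dvd_pow y n.le_succ)) _
    let g := Submodule.factor hle
    have hmap : I ⊔ Ideal.span {y} ≤ Submodule.comap (LinearMap.mulLeft S (y ^ n))
        (I ⊔ Ideal.span {y ^ (n + 1)}) := by
      rw [sup_le_iff]
      refine ⟨fun x hx => Ideal.mem_sup_left (I.mul_mem_left _ hx), ?_⟩
      rw [Ideal.span_singleton_le_iff_mem]
      refine Ideal.mem_sup_right ?_
      rw [LinearMap.mulLeft_apply, ← pow_succ]
      exact Ideal.mem_span_singleton_self _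
    let f := Submodule.mapQ _ _ (LinearMap.mulLeft S (y ^ n)) hmap
    have hker : LinearMap.ker g ≤ LinearMap.range f := by
      intro z hz
      obtain ⟨z, rfl⟩ := Submodule.Quotient.mk_surjective _ z
      have hz' : Submodule.Quotient.mk z = (0 : S ⧸ (I ⊔ Ideal.span {y ^ n})) := hz
      rw [Submodule.Quotient.mk_eq_zero] at hz'
      obtain ⟨i, hi, j, hj, rfl⟩ := Submodule.mem_sup.mp hz'
      obtain ⟨c, rfl⟩ := Ideal.mem_span_singleton.mp hj
      refine ⟨Submodule.Quotient.mk c, ?_⟩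
      change Submodule.Quotient.mk (y ^ n * c) = _
      rw [Submodule.Quotient.eq]
      exact Ideal.mem_sup_left (by simpa using hi)
    have h1 := Module.length_eq_add_of_exact (LinearMap.ker g).subtype g
      (Submodule.subtype_injective _) (Submodule.factor_surjective hle)
      (LinearMap.exact_subtype_ker_map g)
    have h2 : Module.length S (LinearMap.ker g) ≤ Module.length S (S ⧸ (I ⊔ Ideal.span {y})) :=
      (Module.length_le_of_injective (Submodule.inclusion hker)
        (Submodule.inclusion_injective hker)).trans
        (Module.length_le_of_surjective f.rangeRestrict f.surjective_rangeRestrict)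
    rw [h1, Nat.cast_succ, add_mul, one_mul, add_comm]
    exact add_le_add ih h2

variable [IsLocalRing S]

theorem length_quotient_sup_pow_le {I : Ideal S} {y : S} (hy : y ∈ maximalIdeal S) {a : ℕ}
    (ha : maximalIdeal S ^ a ≤ I ⊔ Ideal.span {y}) (n : ℕ) :
    Module.length S (S ⧸ (I ⊔ maximalIdeal S ^ n)) ≤
      n * Module.length S (S ⧸ maximalIdeal S ^ a) := by
  have h : I ⊔ Ideal.span {y ^ n} ≤ I ⊔ maximalIdeal S ^ n := by
    refine sup_le_sup_left ?_ _
    rw [Ideal.span_singleton_le_iff_mem]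
    exact Ideal.pow_mem_pow hy n
  exact (length_quotient_anti h).trans ((length_quotient_sup_span_pow_le I y n).trans
    (mul_le_mul_right (length_quotient_anti ha) _))

variable [IsNoetherianRing S]

theorem length_quotient_ne_top_of_pow_le {J : Ideal S} {n : ℕ} (h : maximalIdeal S ^ n ≤ J) :
    Module.length S (S ⧸ J) ≠ ⊤ := by
  have := isArtinianRing_quotient_of_pow_le h
  have : IsArtinian S (S ⧸ J) :=
    isArtinian_of_surjective_algebraMap (R := S ⧸ J) Ideal.Quotient.mk_surjective
  exact Module.length_ne_top

/-- An ideal not containing the `n`-th power of the maximal ideal has colength at least `n`, and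
this is already seen modulo that power. -/
theorem le_length_quotient_sup_pow {I : Ideal S} {n : ℕ} (h : ¬ maximalIdeal S ^ n ≤ I) :
    (n : ℕ∞) ≤ Module.length S (S ⧸ (I ⊔ maximalIdeal S ^ n)) := by
  suffices ∀ j ≤ n, (j : ℕ∞) ≤ Module.length S (S ⧸ (I ⊔ maximalIdeal S ^ j)) from this n le_rfl
  intro j hj
  induction j with
  | zero => simp
  | succ j ih =>
    rw [Nat.cast_succ]
    refine (add_le_add_left (ih (by omega)) 1).trans (length_quotient_add_one_le ?_)
    refine lt_of_le_not_ge (sup_le_sup_left (Ideal.pow_le_pow_right j.le_succ) _) fun hle => h ?_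
    refine (Ideal.pow_le_pow_right (by omega : j ≤ n)).trans ?_
    refine Submodule.le_of_le_smul_of_le_jacobson_bot (IsNoetherian.noetherian _)
      (IsLocalRing.maximalIdeal_le_jacobson ⊥) ?_
    rw [smul_eq_mul, ← pow_succ']
    exact le_sup_right.trans hle

end Length

section Counting

theorem Ideal.mul_le_sup_inf {S : Type*} [CommRing S] {X Y Z K L : Ideal S} (h : K ≤ Y ⊔ X)
    (h' : L ≤ Z ⊔ X) : K * L ≤ (Y ⊓ Z) ⊔ X := by
  refine (Ideal.mul_mono h h').trans ?_
  rw [Ideal.sup_mul, Ideal.mul_sup]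
  refine sup_le (sup_le (le_sup_of_le_left Ideal.mul_le_inf) ?_) ?_
  · exact le_sup_of_le_right Ideal.mul_le_right
  · exact le_sup_of_le_right Ideal.mul_le_left

/-- Greedy choice: if every element is incompatible with fewer than `r` others, there are `ρ`
pairwise compatible elements among `ρ * r`. -/
theorem Finset.exists_pairwise_of_card_filter_lt {ι : Type*} [DecidableEq ι] (good : ι → ι → Prop)
    [DecidableRel good] (hsymm : ∀ i j, good i j → good j i) {r : ℕ} (hr : 0 < r) (ρ : ℕ)
    (s : Finset ι)
    (hbad : ∀ i ∈ s, (s.filter fun j => j ≠ i ∧ ¬ good i j).card < r) (hs : ρ * r ≤ s.card) :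
    ∃ t ⊆ s, t.card = ρ ∧ (t : Set ι).Pairwise good := by
  induction ρ generalizing s with
  | zero => exact ⟨∅, by simp, by simp, by simp⟩
  | succ ρ ih =>
    obtain rfl | ⟨i, hi⟩ := s.eq_empty_or_nonempty
    · simp [hr.ne'] at hs
    have h1 : (s.filter fun j => j ≠ i ∧ good i j) ⊆ s := Finset.filter_subset _ _
    obtain ⟨t, ht, hc, hp⟩ := ih (s.filter fun j => j ≠ i ∧ good i j)
      (fun j hj => (Finset.card_le_card (Finset.filter_subset_filter _ h1)).trans_lt
        (hbad j (h1 hj))) (by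
        have h2 : s ⊆ insert i ((s.filter fun j => j ≠ i ∧ good i j) ∪
            (s.filter fun j => j ≠ i ∧ ¬ good i j)) := by
          intro j hj
          by_cases hji : j = i
          · simp [hji]
          · by_cases hg : good i j <;> simp [hji, hg, hj]
        have h3 := (Finset.card_le_card h2).trans (Finset.card_insert_le _ _)
        have h4 := Finset.card_union_le (s.filter fun j => j ≠ i ∧ good i j)
            (s.filter fun j => j ≠ i ∧ ¬ good i j)
        have h5 := hbad i hi
        rw [add_mul, one_mul] at hs
        omega)
    have hit : i ∉ t := fun h => by simpa using ht h
    refine ⟨insert i t, Finset.insert_subset hi (ht.trans h1), by simp [hit, hc], ?_⟩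
    rw [Finset.coe_insert]
    have hg : ∀ j ∈ t, good i j := fun j hj => (Finset.mem_filter.mp (ht hj)).2.2
    exact hp.insert fun j hj _ => ⟨hg j hj, hsymm _ _ (hg j hj)⟩

variable {S : Type*} [CommRing S] [IsLocalRing S] [IsNoetherianRing S]

theorem exists_pow_le_of_pairwise {α ρ h : ℕ} (hαρ : α < ρ) :
    ∃ n : ℕ, ∀ 𝔞 : Ideal S, (∀ n : ℕ, Module.length S (S ⧸ (𝔞 ⊔ maximalIdeal S ^ n)) ≤ n * α) →
      ∀ (s : Finset ℕ) (I : ℕ → Ideal S), s.card = ρ → (∀ i ∈ s, 𝔞 ≤ I i) →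
        (∀ i ∈ s, ∀ j ∈ s, i ≠ j → maximalIdeal S ^ h ≤ I i ⊔ I j) →
        ∃ i ∈ s, maximalIdeal S ^ n ≤ I i := by
  obtain ⟨B, hB⟩ := ENat.ne_top_iff_exists.mp
    (length_quotient_ne_top_of_pow_le (le_refl (maximalIdeal S ^ (h * ρ))))
  refine ⟨ρ * B + 1, fun 𝔞 h𝔞 s I hs hI hpair => ?_⟩
  set n := ρ * B + 1 with hn
  by_contra! hbad
  have key : ∀ u ⊆ s, maximalIdeal S ^ n ⊔ 𝔞 ≤ u.inf (fun i => I i ⊔ maximalIdeal S ^ n) ∧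
      ((u.card * n : ℕ) : ℕ∞) ≤
        Module.length S (S ⧸ u.inf (fun i => I i ⊔ maximalIdeal S ^ n)) + (u.card * B : ℕ) := by
    intro u
    induction u using Finset.induction_on with
    | empty => simp
    | insert i u hiu ih =>
      intro hu
      have his : i ∈ s := hu (Finset.mem_insert_self _ _)
      have hus : u ⊆ s := (Finset.subset_insert _ _).trans hu
      obtain ⟨ih1, ih2⟩ := ih hus
      rw [Finset.inf_insert, Finset.card_insert_of_notMem hiu]
      refine ⟨le_inf (sup_le le_sup_right ((hI i his).trans le_sup_left)) ih1, ?_⟩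
      have h1 := le_length_quotient_sup_pow (hbad i his)
      have h2 := length_quotient_add_length_quotient_le (I i ⊔ maximalIdeal S ^ n)
        (u.inf (fun i => I i ⊔ maximalIdeal S ^ n))
      have h3 : ∀ v ⊆ u, maximalIdeal S ^ (h * v.card) ≤
          v.inf (fun i => I i ⊔ maximalIdeal S ^ n) ⊔ (I i ⊔ maximalIdeal S ^ n) := by
        intro v
        induction v using Finset.induction_on with
        | empty => simp
        | insert j v hjv ihv =>
          intro hv
          rw [Finset.inf_insert, Finset.card_insert_of_notMem hjv, mul_add, mul_one, add_comm,
            pow_add]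
          refine Ideal.mul_le_sup_inf ?_ (ihv ((Finset.subset_insert _ _).trans hv))
          have hju : j ∈ u := hv (Finset.mem_insert_self _ _)
          exact (hpair j (hus hju) i his (fun hji => hiu (hji ▸ hju))).trans
            (sup_le_sup le_sup_left le_sup_left)
      have h4 : Module.length S (S ⧸ ((I i ⊔ maximalIdeal S ^ n) ⊔
          u.inf (fun i => I i ⊔ maximalIdeal S ^ n))) ≤ B := by
        rw [hB]
        refine length_quotient_anti (le_trans (Ideal.pow_le_pow_right ?_)
          ((h3 u subset_rfl).trans_eq (sup_comm _ _)))
        exact Nat.mul_le_mul_left _ (hs ▸ Finset.card_le_card hus)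
      calc (((u.card + 1) * n : ℕ) : ℕ∞) = n + (u.card * n : ℕ) := by push_cast; ring
        _ ≤ Module.length S (S ⧸ (I i ⊔ maximalIdeal S ^ n)) + (Module.length S
            (S ⧸ u.inf (fun i => I i ⊔ maximalIdeal S ^ n)) + (u.card * B : ℕ)) :=
          add_le_add h1 ih2
        _ ≤ _ := by
          rw [← add_assoc]
          refine (add_le_add_left (h2.trans (add_le_add_right h4 _)) _).trans_eq ?_
          push_cast
          ring
  obtain ⟨h1, h2⟩ := key s subset_rfl
  rw [sup_comm] at h1
  have h3 := h2.trans (add_le_add_left ((length_quotient_anti h1).trans (h𝔞 n)) _)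
  rw [hs] at h3
  have h4 : ρ * n ≤ n * α + ρ * B := by exact_mod_cast h3
  have h5 : n * (α + 1) ≤ n * ρ := Nat.mul_le_mul_left _ hαρ
  rw [mul_add, mul_one, mul_comm n ρ] at h5
  omega

theorem exists_pow_le_of_card_le (α q : ℕ) :
    ∃ r : ℕ, ∀ h : ℕ, ∃ n : ℕ, ∀ 𝔞 : Ideal S,
      (∀ n : ℕ, Module.length S (S ⧸ (𝔞 ⊔ maximalIdeal S ^ n)) ≤ n * α) →
      ∀ (s : Finset ℕ) (I : ℕ → Ideal S), r ≤ s.card → (∀ i ∈ s, 𝔞 ≤ I i) →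
        (∀ A ⊆ s, A.card = q + 1 → maximalIdeal S ^ h ≤ A.sup I) →
        ∃ i ∈ s, maximalIdeal S ^ n ≤ I i := by
  classical
  induction q with
  | zero =>
    refine ⟨1, fun h => ⟨h, fun 𝔞 _ s I hs _ hA => ?_⟩⟩
    obtain ⟨i, hi⟩ := Finset.card_pos.mp hs
    exact ⟨i, hi, by simpa using hA {i} (by simpa using hi) (by simp)⟩
  | succ q ih =>
    obtain ⟨r, hr⟩ := ih
    refine ⟨(α + 1) * (r + 1), fun h => ?_⟩
    obtain ⟨h', hh'⟩ := hr h
    obtain ⟨n, hn⟩ := exists_pow_le_of_pairwise (S := S) (h := h') (lt_add_one α)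
    refine ⟨n, fun 𝔞 h𝔞 s I hs hI hA => ?_⟩
    have hbad : ∀ i ∈ s, (s.filter fun j => j ≠ i ∧ ¬ maximalIdeal S ^ h' ≤ I i ⊔ I j).card <
        r + 1 := by
      intro i hi
      by_contra! hcard
      obtain ⟨j, hj, hle⟩ := hh' 𝔞 h𝔞 _ (fun j => I i ⊔ I j) ((Nat.le_succ r).trans hcard)
        (fun j _ => (hI i hi).trans le_sup_left) (fun A hAs hAc => by
          have hiA : i ∉ A := fun h => by simpa using hAs h
          refine (hA (insert i A) (Finset.insert_subset hi
            (hAs.trans (Finset.filter_subset _ _))) (by simp [hiA, hAc])).trans ?_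
          obtain ⟨j, hj⟩ := Finset.card_pos.mp (by omega : 0 < A.card)
          rw [Finset.sup_insert]
          exact sup_le (le_sup_left.trans (Finset.le_sup (f := fun j => I i ⊔ I j) hj))
            (Finset.sup_mono_fun fun _ _ => le_sup_right))
      exact (Finset.mem_filter.mp hj).2.2 hle
    obtain ⟨t, ht, htc, htp⟩ := Finset.exists_pairwise_of_card_filter_lt
      (fun i j => maximalIdeal S ^ h' ≤ I i ⊔ I j) (fun i j hij => hij.trans_eq (sup_comm _ _))
      r.succ_pos (α + 1) s hbad hs
    obtain ⟨i, hi, hle⟩ := hn 𝔞 h𝔞 t I htc (fun i hi => hI i (ht hi))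
      (fun i hi j hj hij => htp hi hj hij)
    exact ⟨i, ht hi, hle⟩

end Counting

section Parameters

variable {S : Type*} [CommRing S]

theorem ringKrullDim_quotient_eq_coheight (Q : PrimeSpectrum S) :
    ringKrullDim (S ⧸ Q.asIdeal) = Order.coheight Q := by
  rw [ringKrullDim_quotient, Order.coheight_eq_krullDim_Ici]
  rfl

variable [IsLocalRing S]

theorem eq_closedPoint_of_coheight_le_zero {Q : PrimeSpectrum S} (h : Order.coheight Q ≤ 0) :
    Q = closedPoint S := by
  have h1 : IsMax Q := Order.coheight_eq_zero.mp (le_antisymm h bot_le)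
  exact le_antisymm (le_maximalIdeal Q.2.ne_top) (h1 (le_maximalIdeal Q.2.ne_top))

theorem coheight_closedPoint : Order.coheight (closedPoint S) = 0 :=
  Order.coheight_eq_zero.mpr fun Q _ => le_maximalIdeal Q.2.ne_top

variable [IsNoetherianRing S]

theorem exists_maximalIdeal_pow_le {J : Ideal S}
    (hJ : ∀ Q : PrimeSpectrum S, J ≤ Q.asIdeal → Q = closedPoint S) :
    ∃ h : ℕ, maximalIdeal S ^ h ≤ J := by
  obtain ⟨n, hn⟩ := J.exists_radical_pow_le_of_fg (IsNoetherian.noetherian _)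
  refine ⟨n, (Ideal.pow_right_mono ?_ n).trans hn⟩
  rw [Ideal.radical_eq_sInf]
  refine le_sInf fun Q hQ => ?_
  have := hJ ⟨Q, hQ.2⟩ hQ.1
  exact (congrArg PrimeSpectrum.asIdeal this).ge

/-- Elements of the maximal ideal any few of which cut the dimension of `S ⧸ I` down as far as
possible. -/
theorem exists_parameters (I : Ideal S) (d : ℕ)
    (hI : ∀ Q : PrimeSpectrum S, I ≤ Q.asIdeal → Order.coheight Q ≤ d) (r : ℕ) :
    ∃ t : ℕ → S, (∀ i, t i ∈ maximalIdeal S) ∧ ∀ A ⊆ Finset.range r, ∀ Q : PrimeSpectrum S,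
      I ⊔ Ideal.span (t '' A) ≤ Q.asIdeal →
      Q = closedPoint S ∨ Order.coheight Q + A.card ≤ d := by
  classical
  induction r with
  | zero =>
    refine ⟨0, by simp, fun A hA Q hQ => Or.inr ?_⟩
    obtain rfl : A = ∅ := by simpa using hA
    simpa using hI Q (le_sup_left.trans hQ)
  | succ r ih =>
    obtain ⟨t, htm, ht⟩ := ih
    set s : Set (Ideal S) := (⋃ A ∈ (Finset.range r).powerset,
      (I ⊔ Ideal.span (t '' A)).minimalPrimes) \ {maximalIdeal S} with hs
    have hsfin : s.Finite := by
      refine Set.Finite.sdiff ?_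
      refine Set.Finite.biUnion (Finset.finite_toSet _) fun A _ => ?_
      exact Ideal.finite_minimalPrimes_of_isNoetherianRing S _
    have hsprime : ∀ P ∈ s, P.IsPrime := by
      rintro P ⟨hP, -⟩
      simp only [Set.mem_iUnion] at hP
      obtain ⟨A, -, hA⟩ := hP
      exact hA.1.1
    obtain ⟨x, hxm, hx⟩ : ∃ x ∈ maximalIdeal S, ∀ P ∈ s, x ∉ P := by
      by_contra! hcon
      obtain ⟨P, hP, hle⟩ := (Ideal.subset_union_prime_finite hsfin (f := id) ⊤ ⊤
        (fun P hP _ _ => hsprime P hP) (I := maximalIdeal S)).mp (fun x hx => by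
          obtain ⟨P, hP, hxP⟩ := hcon x hx
          exact Set.mem_biUnion hP hxP)
      exact hP.2 (le_antisymm (le_maximalIdeal (hsprime P hP).ne_top) hle)
    refine ⟨Function.update t r x, fun i => ?_, fun A hA Q hQ => ?_⟩
    · by_cases hi : i = r
      · simpa [hi] using hxm
      · simpa [hi] using htm i
    have himg : ∀ B ⊆ Finset.range r, Function.update t r x '' B = t '' B := by
      intro B hB
      refine Set.image_congr fun i hi => ?_
      have := Finset.mem_range.mp (hB hi)
      simp [this.ne]
    by_cases hrA : r ∈ A
    · have hB : A.erase r ⊆ Finset.range r := by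
        intro i hi
        have h1 := Finset.mem_range.mp (hA (Finset.mem_of_mem_erase hi))
        have h2 := Finset.ne_of_mem_erase hi
        rw [Finset.mem_range]
        omega
      have hxQ : x ∈ Q.asIdeal := hQ (Ideal.mem_sup_right (Ideal.subset_span ⟨r, hrA, by simp⟩))
      have hBQ : I ⊔ Ideal.span (t '' (A.erase r : Finset ℕ)) ≤ Q.asIdeal := by
        refine le_trans (sup_le_sup_left (Ideal.span_mono ?_) _) hQ
        rw [← himg _ hB]
        exact Set.image_mono (by simp)
      obtain ⟨P, hP, hPQ⟩ := Ideal.exists_minimalPrimes_le hBQ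
      by_cases hPm : P = maximalIdeal S
      · exact Or.inl (PrimeSpectrum.ext
          (le_antisymm (le_maximalIdeal Q.2.ne_top) (hPm.symm.trans_le hPQ)))
      have hPs : P ∈ s := ⟨Set.mem_biUnion (Finset.mem_coe.mpr (Finset.mem_powerset.mpr hB)) hP, hPm⟩
      right
      have h1 := (ht _ hB ⟨P, hP.1.1⟩ hP.1.2).resolve_left
        (fun h => hPm (congrArg PrimeSpectrum.asIdeal h))
      have h2 : Order.coheight Q + 1 ≤ Order.coheight (⟨P, hP.1.1⟩ : PrimeSpectrum S) := by
        refine Order.coheight_add_one_le (lt_of_le_not_ge hPQ fun h => hx P hPs (h hxQ))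
      rw [← Finset.card_erase_add_one hrA, Nat.cast_add, Nat.cast_one, add_comm (_ : ℕ∞) 1,
        ← add_assoc]
      exact (add_le_add_left h2 _).trans h1
    · have hB : A ⊆ Finset.range r := by
        intro i hi
        have h1 := Finset.mem_range.mp (hA hi)
        have h2 : i ≠ r := fun h => hrA (h ▸ hi)
        rw [Finset.mem_range]
        omega
      rw [himg A hB] at hQ
      exact ht A hB Q hQ

/-- Cutting by one element lowers the dimension by at most one. -/
theorem exists_le_coheight_of_mem_maximalIdeal (P : PrimeSpectrum S) {k : ℕ}
    (hP : (k + 1 : ℕ) ≤ Order.coheight P) {t : S} (ht : t ∈ maximalIdeal S) :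
    ∃ Q : PrimeSpectrum S, P ≤ Q ∧ t ∈ Q.asIdeal ∧ k ≤ Order.coheight Q := by
  let A := S ⧸ P.asIdeal
  have : IsLocalRing A :=
    IsLocalRing.of_surjective' (Ideal.Quotient.mk _) Ideal.Quotient.mk_surjective
  have : IsLocalHom (Ideal.Quotient.mk P.asIdeal) :=
    IsLocalHom.of_surjective _ Ideal.Quotient.mk_surjective
  let t' : A := Ideal.Quotient.mk _ t
  have ht' : t' ∈ maximalIdeal A := by
    rw [IsLocalRing.mem_maximalIdeal, map_mem_nonunits_iff]
    exact ht
  have h1 := Ideal.height_le_ringKrullDim_quotient_add_one ht'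
  rw [IsLocalRing.maximalIdeal_height_eq_ringKrullDim, ringKrullDim_quotient_eq_coheight] at h1
  have h2 : ((k : ℕ) : WithBot ℕ∞) ≤ ringKrullDim (A ⧸ Ideal.span {t'}) := by
    have h3 : ((k + 1 : ℕ) : WithBot ℕ∞) ≤ ringKrullDim (A ⧸ Ideal.span {t'}) + 1 :=
      le_trans (by exact_mod_cast hP) h1
    rw [Nat.cast_succ] at h3
    exact ENat.WithBot.add_le_add_one_right_iff.mp h3
  obtain ⟨l, hl⟩ := Order.le_krullDim_iff.mp h2
  let f : S →+* A ⧸ Ideal.span {t'} := (Ideal.Quotient.mk _).comp (Ideal.Quotient.mk _)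
  have hf : Function.Surjective f :=
    Ideal.Quotient.mk_surjective.comp Ideal.Quotient.mk_surjective
  have hmono : StrictMono (PrimeSpectrum.comap f) :=
    Monotone.strictMono_of_injective (fun a b hab => Ideal.comap_mono hab)
      (PrimeSpectrum.comap_injective_of_surjective f hf)
  have hk := Order.length_le_coheight_head (p := l.map _ hmono)
  refine ⟨_, ?_, ?_, hl ▸ hk⟩
  · intro x hx
    change f x ∈ l.head.asIdeal
    have : f x = 0 := by
      change Ideal.Quotient.mk _ (Ideal.Quotient.mk _ x) = 0
      rw [Ideal.Quotient.eq_zero_iff_mem.mpr hx, map_zero]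
    rw [this]; exact zero_mem _
  · change f t ∈ l.head.asIdeal
    have : f t = 0 := Ideal.Quotient.eq_zero_iff_mem.mpr (Ideal.mem_span_singleton_self _)
    rw [this]; exact zero_mem _

end Parameters

section Saturation

variable {S M : Type*} [CommRing S] [AddCommGroup M] [Module S M]

theorem Submodule.exists_saturation [IsNoetherian S M] (U : Submodule S M) (c : S) :
    ∃ j : ℕ, ∀ (i : ℕ) (v : M), c ^ i • v ∈ U → c ^ j • v ∈ U := by
  obtain ⟨j, hj⟩ := monotone_stabilizes_iff_noetherian.mpr (inferInstanceAs (IsNoetherian S M))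
    ⟨fun i => U.comap (LinearMap.lsmul S M (c ^ i)), monotone_nat_of_le_succ fun i v hv => by
      change c ^ (i + 1) • v ∈ U
      rw [pow_succ', mul_smul]
      exact U.smul_mem _ hv⟩
  refine ⟨j, fun i v hv => ?_⟩
  have h1 : v ∈ U.comap (LinearMap.lsmul S M (c ^ (j + i))) := by
    change c ^ (j + i) • v ∈ U
    rw [pow_add, mul_smul]
    exact U.smul_mem _ hv
  have h2 := hj (j + i) (Nat.le_add_right _ _)
  change U.comap (LinearMap.lsmul S M (c ^ j)) = U.comap (LinearMap.lsmul S M (c ^ (j + i))) at h2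
  rw [← h2] at h1
  exact h1

variable [IsNoetherianRing S]

theorem isSMulRegular_of_forall_notMem {t : S} (ht : ∀ P ∈ associatedPrimes S M, t ∉ P) :
    IsSMulRegular M t := by
  by_contra hx
  have h2 : t ∈ ({r | IsSMulRegular M r}ᶜ : Set S) := hx
  rw [← biUnion_associatedPrimes_eq_compl_regular S M] at h2
  obtain ⟨P, hP, hx⟩ := Set.mem_iUnion₂.mp h2
  exact ht P hP hx

variable [Module.Finite S M]

/-- An element whose multiples by powers of `e` are divisible by all powers of `t` vanishes, when
`t` and `e` can be separated at every associated prime. -/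
theorem eq_zero_of_forall_exists_pow_smul_eq {t e : S}
    (hsep : ∀ P ∈ associatedPrimes S M, ∃ Q : PrimeSpectrum S, P ≤ Q.asIdeal ∧ t ∈ Q.asIdeal ∧
      e ∉ Q.asIdeal) {v : M} (hv : ∀ β : ℕ, ∃ i : ℕ, ∃ w : M, e ^ i • v = t ^ β • w) : v = 0 := by
  by_contra hv0
  obtain ⟨P, hP, hvP⟩ := exists_le_isAssociatedPrime_of_isNoetherianRing S v hv0
  obtain ⟨Q, hPQ, htQ, heQ⟩ := hsep P hP
  let A := Localization.AtPrime Q.asIdeal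
  have hH : IsHausdorff (maximalIdeal A) (LocalizedModule Q.asIdeal.primeCompl M) := inferInstance
  have h0 : LocalizedModule.mkLinearMap Q.asIdeal.primeCompl M v = 0 := by
    refine hH.haus _ fun β => ?_
    rw [SModEq.zero]
    obtain ⟨i, w, hw⟩ := hv β
    have h1 : (algebraMap S A (e ^ i)) • LocalizedModule.mkLinearMap Q.asIdeal.primeCompl M v ∈
        maximalIdeal A ^ β • (⊤ : Submodule A (LocalizedModule Q.asIdeal.primeCompl M)) := by
      rw [algebraMap_smul, ← map_smul, hw, map_smul, ← algebraMap_smul A (t ^ β), map_pow]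
      refine Submodule.smul_mem_smul (Ideal.pow_mem_pow ?_ _) Submodule.mem_top
      exact (IsLocalization.AtPrime.to_map_mem_maximal_iff A Q.asIdeal t).mpr htQ
    have hu : IsUnit (algebraMap S A (e ^ i)) :=
      IsLocalization.map_units A (⟨e ^ i, fun h => heQ (Q.2.mem_of_pow_mem _ h)⟩ :
        Q.asIdeal.primeCompl)
    obtain ⟨u, hu⟩ := hu
    rw [← hu] at h1
    have h2 := Submodule.smul_mem _ (↑u⁻¹ : A) h1
    rwa [smul_smul, Units.inv_mul, one_smul] at h2
  obtain ⟨s, hs⟩ := (IsLocalizedModule.eq_zero_iff Q.asIdeal.primeCompl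
    (LocalizedModule.mkLinearMap Q.asIdeal.primeCompl M)).mp h0
  exact s.2 (hPQ (hvP (Submodule.mem_colon_singleton.mpr hs)))

theorem exists_separating_element [IsLocalRing S] {k : ℕ}
    (hM : ∀ P : PrimeSpectrum S, P.asIdeal ∈ associatedPrimes S M → (k + 1 : ℕ) ≤ Order.coheight P)
    {t : S} (htm : t ∈ maximalIdeal S) (s : Set (Ideal S)) (hs : s.Finite) :
    ∃ c : S, (∀ Q : PrimeSpectrum S, Q.asIdeal ∈ s → Order.coheight Q < k → c ∈ Q.asIdeal) ∧
      ∀ P ∈ associatedPrimes S M, ∃ Q : PrimeSpectrum S, P ≤ Q.asIdeal ∧ t ∈ Q.asIdeal ∧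
        c ∉ Q.asIdeal := by
  classical
  have h1 : ∀ P ∈ associatedPrimes S M, ∃ Q : PrimeSpectrum S, P ≤ Q.asIdeal ∧ t ∈ Q.asIdeal ∧
      k ≤ Order.coheight Q := by
    intro P hP
    obtain ⟨Q, h1, h2, h3⟩ := exists_le_coheight_of_mem_maximalIdeal ⟨P, hP.1⟩ (hM ⟨P, hP.1⟩ hP) htm
    exact ⟨Q, h1, h2, h3⟩
  choose! q hq1 hq2 hq3 using h1
  let E : Set (Ideal S) := {Q ∈ s | ∃ hQ : Q.IsPrime, Order.coheight (⟨Q, hQ⟩ : PrimeSpectrum S) < k}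
  have hE : E.Finite := hs.subset fun Q hQ => hQ.1
  let J : Ideal S := ∏ Q ∈ hE.toFinset, Q
  obtain ⟨c, hcJ, hc⟩ : ∃ c ∈ J, ∀ P ∈ associatedPrimes S M, c ∉ (q P).asIdeal := by
    by_contra! hcon
    obtain ⟨P, hP, hle⟩ := (Ideal.subset_union_prime_finite (associatedPrimes.finite S M)
      (f := fun P => (q P).asIdeal) ⊤ ⊤ (fun P hP _ _ => (q P).2) (I := J)).mp (fun x hx => by
        obtain ⟨P, hP, hxP⟩ := hcon x hx
        exact Set.mem_biUnion hP hxP)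
    obtain ⟨Q, hQ, hQP⟩ := (Ideal.IsPrime.prod_le (q P).2).mp hle
    obtain ⟨-, hQp, hQk⟩ := hE.mem_toFinset.mp hQ
    have h2 : Order.coheight (q P) ≤ Order.coheight (⟨Q, hQp⟩ : PrimeSpectrum S) :=
      Order.coheight_anti hQP
    exact absurd ((hq3 P hP).trans h2) (not_le.mpr hQk)
  refine ⟨c, fun Q hQs hQk => ?_, fun P hP => ⟨q P, hq1 P hP, hq2 P hP, hc P hP⟩⟩
  have h2 : Q.asIdeal ∈ hE.toFinset := hE.mem_toFinset.mpr ⟨hQs, Q.2, hQk⟩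
  exact (Ideal.prod_le_inf.trans (Finset.inf_le h2)) hcJ

end Saturation

section Descent

variable {S M : Type*} [CommRing S] [IsLocalRing S] [IsNoetherianRing S]
  [AddCommGroup M] [Module S M] [Module.Finite S M]

theorem Submodule.mkQ_mem_pow_smul_top_iff {S M : Type*} [CommRing S] [AddCommGroup M] [Module S M]
    (I : Ideal S) (N : Submodule S M) (v : M) :
    N.mkQ v ∈ I • (⊤ : Submodule S (M ⧸ N)) ↔ v ∈ N ⊔ I • ⊤ := by
  have h : I • (⊤ : Submodule S (M ⧸ N)) = (I • ⊤ : Submodule S M).map N.mkQ := by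
    rw [Submodule.map_smul'', Submodule.map_top, Submodule.range_mkQ]
  rw [h, ← Submodule.mem_comap, Submodule.comap_map_mkQ]

theorem exists_forall_mem_pow_smul_top_of_smul_mem {t : S} (ht : IsSMulRegular M t) :
    ∃ κ : ℕ, ∀ (n : ℕ) (v : M), t • v ∈ maximalIdeal S ^ (n + κ) • (⊤ : Submodule S M) →
      v ∈ maximalIdeal S ^ n • (⊤ : Submodule S M) := by
  obtain ⟨κ, hκ⟩ := (LinearMap.lsmul S M t).exists_artinRees (maximalIdeal S)
  refine ⟨κ, fun n v hv => ?_⟩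
  obtain ⟨z, hz, hzv⟩ := hκ n v hv
  rwa [ht hzv] at hz

/-- A uniform bound modulo `t`, up to multiplication by `e`, yields uniform bounds modulo all
powers of `t`, up to multiplication by powers of `e`. -/
theorem exists_uniform_bound_pow {t e : S} (ht : IsSMulRegular M t) {N' : Submodule S M}
    (hN' : ∀ v ∈ N', ∃ w, e • v = t • w) {X : Set S}
    (hX : ∀ b : ℕ, ∃ N : ℕ, ∀ x ∈ X, ∀ v : M, x • v ∈ maximalIdeal S ^ N • (⊤ : Submodule S M) →
      v ∈ N' ⊔ maximalIdeal S ^ b • ⊤) (β : ℕ) :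
    ∀ n : ℕ, ∃ N : ℕ, ∀ x ∈ X, ∀ v : M, x • v ∈ maximalIdeal S ^ N • (⊤ : Submodule S M) →
      ∃ w : M, ∃ u ∈ maximalIdeal S ^ n • (⊤ : Submodule S M), e ^ β • v = t ^ β • w + u := by
  have hanti : ∀ {i j : ℕ}, i ≤ j → maximalIdeal S ^ j • (⊤ : Submodule S M) ≤
      maximalIdeal S ^ i • ⊤ := fun hij => Submodule.smul_mono_left (Ideal.pow_le_pow_right hij)
  obtain ⟨κ, hκ⟩ := exists_forall_mem_pow_smul_top_of_smul_mem ht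
  induction β with
  | zero => exact fun n => ⟨0, fun x _ v _ => ⟨v, 0, zero_mem _, by simp⟩⟩
  | succ β ih =>
    intro n
    obtain ⟨N₁, hN₁⟩ := ih n
    obtain ⟨N₂, hN₂⟩ := hX (max n (N₁ + κ))
    refine ⟨max N₂ (N₁ + κ), fun x hx v hv => ?_⟩
    obtain ⟨v₀, hv₀, u₀, hu₀, rfl⟩ := Submodule.mem_sup.mp
      (hN₂ x hx v (hanti (le_max_left _ _) hv))
    obtain ⟨v', hv'⟩ := hN' v₀ hv₀
    have h1 : t • x • v' = e • x • (v₀ + u₀) - (e * x) • u₀ := by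
      rw [smul_comm t x, ← hv', smul_add, smul_add, mul_smul, smul_comm x e]
      abel
    have h2 : x • v' ∈ maximalIdeal S ^ N₁ • (⊤ : Submodule S M) := by
      refine hκ N₁ _ ?_
      rw [h1]
      exact sub_mem (Submodule.smul_mem _ _ (hanti (le_max_right _ _) hv))
        (Submodule.smul_mem _ _ (hanti (le_max_right _ _) hu₀))
    obtain ⟨w, u, hu, hw⟩ := hN₁ x hx v' h2
    refine ⟨w, t • u + e ^ (β + 1) • u₀, add_mem (Submodule.smul_mem _ _ hu)
      (Submodule.smul_mem _ _ (hanti (le_max_left _ _) hu₀)), ?_⟩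
    calc e ^ (β + 1) • (v₀ + u₀) = t • (e ^ β • v') + e ^ (β + 1) • u₀ := by
          rw [smul_add, pow_succ, mul_smul, hv', smul_comm t]
      _ = t ^ (β + 1) • w + (t • u + e ^ (β + 1) • u₀) := by
          rw [hw, smul_add, smul_smul, ← pow_succ', add_assoc]

variable [IsAdicComplete (maximalIdeal S) S]

theorem exists_uniform_bound_of_quotient {t e : S} (ht : IsSMulRegular M t)
    (hsep : ∀ P ∈ associatedPrimes S M, ∃ Q : PrimeSpectrum S, P ≤ Q.asIdeal ∧ t ∈ Q.asIdeal ∧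
      e ∉ Q.asIdeal) {N' : Submodule S M}
    (hN' : ∀ v ∈ N', ∃ w, e • v = t • w) {X : Set S}
    (hX : ∀ b : ℕ, ∃ N : ℕ, ∀ x ∈ X, ∀ v : M, x • v ∈ maximalIdeal S ^ N • (⊤ : Submodule S M) →
      v ∈ N' ⊔ maximalIdeal S ^ b • ⊤) (b : ℕ) :
    ∃ N : ℕ, ∀ x ∈ X, ∀ v : M, x • v ∈ maximalIdeal S ^ N • (⊤ : Submodule S M) →
      v ∈ maximalIdeal S ^ b • (⊤ : Submodule S M) := by
  choose j hj using fun β : ℕ =>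
    (LinearMap.range (LinearMap.lsmul S M (t ^ β))).exists_saturation e
  let L : ℕ → Submodule S M := fun β =>
    (LinearMap.range (LinearMap.lsmul S M (t ^ β))).comap (LinearMap.lsmul S M (e ^ j β))
  have hL : Antitone L := by
    intro β β' hβ v hv
    obtain ⟨w, hw⟩ : e ^ j β' • v ∈ LinearMap.range (LinearMap.lsmul S M (t ^ β')) := hv
    refine hj β (j β') v ⟨t ^ (β' - β) • w, ?_⟩
    rw [← hw, LinearMap.lsmul_apply, LinearMap.lsmul_apply, smul_smul, ← pow_add,
      Nat.add_sub_cancel' hβ]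
  have hinf : ⨅ β, L β = ⊥ := by
    rw [eq_bot_iff]
    intro v hv
    rw [Submodule.mem_iInf] at hv
    refine eq_zero_of_forall_exists_pow_smul_eq hsep fun β => ?_
    obtain ⟨w, hw⟩ : e ^ j β • v ∈ LinearMap.range (LinearMap.lsmul S M (t ^ β)) := hv β
    exact ⟨j β, w, hw.symm⟩
  obtain ⟨β, hβ⟩ := exists_le_pow_smul_top_of_iInf_eq_bot L hL hinf b
  let f : M →ₗ[S] M ⧸ LinearMap.range (LinearMap.lsmul S M (t ^ β)) :=
    (Submodule.mkQ _).comp (LinearMap.lsmul S M (e ^ β))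
  obtain ⟨κ, hκ⟩ := f.exists_artinRees (maximalIdeal S)
  obtain ⟨N, hN⟩ := exists_uniform_bound_pow ht hN' hX β (b + κ)
  refine ⟨N, fun x hx v hv => ?_⟩
  obtain ⟨w, u, hu, hw⟩ := hN x hx v hv
  obtain ⟨z, hz, hzv⟩ := hκ b v (by
    change Submodule.mkQ _ (e ^ β • v) ∈ _
    rw [Submodule.mkQ_mem_pow_smul_top_iff, hw]
    exact add_mem (Submodule.mem_sup_left ⟨w, rfl⟩) (Submodule.mem_sup_right hu))
  have h1 : z - v ∈ L β := by
    refine hj β β _ ?_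
    rw [← Submodule.Quotient.mk_eq_zero]
    have h2 : f (z - v) = 0 := by rw [map_sub, hzv, sub_self]
    exact h2
  simpa using sub_mem hz (hβ h1)

/-- Cutting down a module all of whose associated primes have the same dimension by a regular
element, and removing the components of too small dimension. -/
theorem exists_quotient_equidimensional {k : ℕ}
    (hM : ∀ P : PrimeSpectrum S, P.asIdeal ∈ associatedPrimes S M →
      Order.coheight P = (k + 2 : ℕ))
    {t : S} (htm : t ∈ maximalIdeal S) (ht : ∀ P ∈ associatedPrimes S M, t ∉ P) :
    ∃ N' : Submodule S M, t ∈ Module.annihilator S (M ⧸ N') ∧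
      (∀ P : PrimeSpectrum S, P.asIdeal ∈ associatedPrimes S (M ⧸ N') →
        Order.coheight P = (k + 1 : ℕ)) ∧
      ∀ X : Set S, (∀ b : ℕ, ∃ N : ℕ, ∀ x ∈ X, ∀ v : M,
        x • v ∈ maximalIdeal S ^ N • (⊤ : Submodule S M) → v ∈ N' ⊔ maximalIdeal S ^ b • ⊤) →
        ∀ b : ℕ, ∃ N : ℕ, ∀ x ∈ X, ∀ v : M,
          x • v ∈ maximalIdeal S ^ N • (⊤ : Submodule S M) →
          v ∈ maximalIdeal S ^ b • (⊤ : Submodule S M) := by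
  set T : Submodule S M := LinearMap.range (LinearMap.lsmul S M t) with hT
  obtain ⟨c, hc, hsep⟩ := exists_separating_element (M := M) (k := k + 1)
    (fun P hP => (hM P hP).ge) htm _ (associatedPrimes.finite S (M ⧸ T))
  obtain ⟨j, hj⟩ := T.exists_saturation c
  have hmem : ∀ v, v ∈ T.comap (LinearMap.lsmul S M (c ^ j)) ↔ c ^ j • v ∈ T := fun v => Iff.rfl
  refine ⟨T.comap (LinearMap.lsmul S M (c ^ j)), ?_, fun Q hQ => ?_, fun X hX b => ?_⟩
  · rw [Module.mem_annihilator]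
    intro v
    obtain ⟨v, rfl⟩ := Submodule.Quotient.mk_surjective _ v
    rw [← Submodule.Quotient.mk_smul, Submodule.Quotient.mk_eq_zero, hmem, smul_comm]
    exact ⟨_, rfl⟩
  · obtain ⟨-, v, hv⟩ := isAssociatedPrime_iff.mp hQ
    obtain ⟨v, rfl⟩ := Submodule.Quotient.mk_surjective _ v
    have hQmem : ∀ s : S, s ∈ Q.asIdeal ↔ c ^ j • s • v ∈ T := by
      intro s
      rw [hv, Submodule.mem_colon_singleton, Submodule.mem_bot, ← Submodule.Quotient.mk_smul,
        Submodule.Quotient.mk_eq_zero, hmem]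
    have hcQ : c ∉ Q.asIdeal := by
      intro h
      have h1 := (hQmem c).mp h
      rw [smul_smul, ← pow_succ] at h1
      have h2 := hj _ _ h1
      rw [← one_smul S v, ← hQmem] at h2
      exact Q.2.ne_top ((Ideal.eq_top_iff_one _).mpr h2)
    have hQT : Q.asIdeal ∈ associatedPrimes S (M ⧸ T) := by
      refine isAssociatedPrime_iff.mpr ⟨Q.2, Submodule.Quotient.mk (c ^ j • v), ?_⟩
      ext s
      rw [hQmem, Submodule.mem_colon_singleton, Submodule.mem_bot, ← Submodule.Quotient.mk_smul,
        Submodule.Quotient.mk_eq_zero, smul_comm]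
    have htQ : t ∈ Q.asIdeal := (hQmem t).mpr (by rw [smul_comm]; exact ⟨_, rfl⟩)
    have hann : Module.annihilator S M ≤ Q.asIdeal := by
      intro s hs
      rw [hQmem, Module.mem_annihilator.mp hs, smul_zero]
      exact zero_mem _
    obtain ⟨P, hP, hPQ⟩ := Ideal.exists_minimalPrimes_le hann
    have hPM := Module.associatedPrimes.minimalPrimes_annihilator_subset_associatedPrimes S M hP
    have h1 : Order.coheight Q + 1 ≤ Order.coheight (⟨P, hP.1.1⟩ : PrimeSpectrum S) :=
      Order.coheight_add_one_le (lt_of_le_not_ge hPQ fun h => ht P hPM (h htQ))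
    rw [hM ⟨P, hP.1.1⟩ hPM] at h1
    have h2 : ((k + 1 : ℕ) : ℕ∞) ≤ Order.coheight Q := not_lt.mp fun h => hcQ (hc Q hQT h)
    refine le_antisymm ?_ h2
    have h3 : ((k + 2 : ℕ) : ℕ∞) = ((k + 1 : ℕ) : ℕ∞) + 1 := by push_cast; ring
    rw [h3] at h1
    exact (ENat.add_le_add_iff_right ENat.one_ne_top).mp h1
  · refine exists_uniform_bound_of_quotient (e := c ^ j)
      (isSMulRegular_of_forall_notMem ht) (fun P hP => ?_) (fun v hv => ?_) hX b
    · obtain ⟨Q, h1, h2, h3⟩ := hsep P hP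
      exact ⟨Q, h1, h2, fun h => h3 (Q.2.mem_of_pow_mem _ h)⟩
    · obtain ⟨w, hw⟩ := (hmem v).mp hv
      exact ⟨w, hw.symm⟩

end Descent

universe v

section Uniform

theorem coheight_le_of_annihilator_le {S M : Type*} [CommRing S] [IsNoetherianRing S]
    [AddCommGroup M] [Module S M] [Module.Finite S M] {d : ℕ}
    (hM : ∀ P : PrimeSpectrum S, P.asIdeal ∈ associatedPrimes S M → Order.coheight P = d)
    (Q : PrimeSpectrum S) (hQ : Module.annihilator S M ≤ Q.asIdeal) : Order.coheight Q ≤ d := by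
  obtain ⟨P, hP, hPQ⟩ := Ideal.exists_minimalPrimes_le hQ
  have hPM := Module.associatedPrimes.minimalPrimes_annihilator_subset_associatedPrimes S M hP
  rw [← hM ⟨P, hP.1.1⟩ hPM]
  exact Order.coheight_anti (show (⟨P, hP.1.1⟩ : PrimeSpectrum S) ≤ Q from hPQ)

variable {S : Type u} [CommRing S] [IsLocalRing S] [IsNoetherianRing S]

theorem exists_parameters_notMem_associatedPrimes {M : Type*} [AddCommGroup M] [Module S M]
    [Module.Finite S M] {d : ℕ} (hd : 1 ≤ d)
    (hM : ∀ P : PrimeSpectrum S, P.asIdeal ∈ associatedPrimes S M → Order.coheight P = d)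
    (r : ℕ) : ∃ t : ℕ → S, ∃ h : ℕ, (∀ i, t i ∈ maximalIdeal S) ∧
      (∀ i < r, ∀ P ∈ associatedPrimes S M, t i ∉ P) ∧
      ∀ A ⊆ Finset.range r, A.card = d →
        maximalIdeal S ^ h ≤ Module.annihilator S M ⊔ Ideal.span (t '' A) := by
  obtain ⟨t, htm, ht⟩ := exists_parameters (Module.annihilator S M) d
    (coheight_le_of_annihilator_le hM) r
  have h1 : ∀ A ∈ (Finset.range r).powerset, ∃ h : ℕ, A.card = d →
      maximalIdeal S ^ h ≤ Module.annihilator S M ⊔ Ideal.span (t '' A) := by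
    intro A hA
    by_cases hc : A.card = d
    · obtain ⟨h, hh⟩ := exists_maximalIdeal_pow_le
        (J := Module.annihilator S M ⊔ Ideal.span (t '' A)) (fun Q hQ => by
          refine (ht A (Finset.mem_powerset.mp hA) Q hQ).elim id fun h2 => ?_
          rw [hc] at h2
          refine eq_closedPoint_of_coheight_le_zero ?_
          exact (ENat.add_le_add_iff_right (ENat.natCast_ne_top d)).mp (h2.trans_eq (zero_add _).symm))
      exact ⟨h, fun _ => hh⟩
    · exact ⟨0, fun h => absurd h hc⟩
  choose! h hh using h1
  refine ⟨t, (Finset.range r).powerset.sup h, htm, fun i hi P hP htP => ?_, fun A hA hc =>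
    (Ideal.pow_le_pow_right (Finset.le_sup (Finset.mem_powerset.mpr hA))).trans
      (hh A (Finset.mem_powerset.mpr hA) hc)⟩
  have hann : Module.annihilator S M ≤ P := by
    rw [← Submodule.annihilator_top]
    exact hP.annihilator_le
  have h2 := ht {i} (by simpa using hi) ⟨P, hP.1⟩
    (sup_le hann (by simpa [Ideal.span_singleton_le_iff_mem] using htP))
  have h3 := hM ⟨P, hP.1⟩ hP
  rcases h2 with h2 | h2
  · rw [h2, coheight_closedPoint] at h3
    have : (0 : ℕ) = d := by exact_mod_cast h3
    omega
  · rw [h3, Finset.card_singleton] at h2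
    have : d + 1 ≤ d := by exact_mod_cast h2
    omega

/-- Over a complete Noetherian local ring, multiplication by parameters of bounded degree on a
module with all associated primes of the same dimension satisfies a uniform Chevalley estimate. -/
theorem exists_uniform_chevalley [IsAdicComplete (maximalIdeal S) S] (k : ℕ) :
    ∀ (a : ℕ) (M : Type v) [AddCommGroup M] [Module S M] [Module.Finite S M],
      (∀ P : PrimeSpectrum S, P.asIdeal ∈ associatedPrimes S M →
        Order.coheight P = (k + 1 : ℕ)) →
      ∀ b : ℕ, ∃ N : ℕ, ∀ x ∈ {x : S | ∃ y : Fin k → S, (∀ i, y i ∈ maximalIdeal S) ∧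
          maximalIdeal S ^ a ≤ Ideal.span {x} ⊔ Ideal.span (Set.range y) ⊔ Module.annihilator S M},
        ∀ v : M, x • v ∈ maximalIdeal S ^ N • (⊤ : Submodule S M) →
          v ∈ maximalIdeal S ^ b • (⊤ : Submodule S M) := by
  induction k with
  | zero =>
    intro a M _ _ _ hM b
    refine ⟨b + a, ?_⟩
    rintro x ⟨y, -, hy⟩ v hv
    have hempty : Ideal.span (Set.range y) = ⊥ := by simp
    rw [hempty, sup_bot_eq] at hy
    have hx : IsSMulRegular M x := by
      refine isSMulRegular_of_forall_notMem fun P hP hxP => ?_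
      have hann : Module.annihilator S M ≤ P := by
        rw [← Submodule.annihilator_top]
        exact hP.annihilator_le
      have h1 := hP.1.le_of_pow_le
        (hy.trans (sup_le ((Ideal.span_singleton_le_iff_mem _).mpr hxP) hann))
      have h2 : (⟨P, hP.1⟩ : PrimeSpectrum S) = closedPoint S :=
        PrimeSpectrum.ext (le_antisymm (le_maximalIdeal hP.1.ne_top) h1)
      have h3 := hM ⟨P, hP.1⟩ hP
      rw [h2, coheight_closedPoint] at h3
      simp at h3
    have h1 : maximalIdeal S ^ a • (⊤ : Submodule S M) ≤
        LinearMap.range (LinearMap.lsmul S M x) := by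
      refine (Submodule.smul_mono_left hy).trans ?_
      rw [Submodule.sup_smul, sup_le_iff, Submodule.smul_le, Submodule.smul_le]
      refine ⟨fun s hs w _ => ?_, fun s hs w _ => ?_⟩
      · obtain ⟨c, rfl⟩ := Ideal.mem_span_singleton.mp hs
        exact ⟨c • w, by rw [LinearMap.lsmul_apply, mul_smul]⟩
      · rw [Module.mem_annihilator.mp hs]
        exact zero_mem _
    rw [pow_add, mul_smul] at hv
    have h2 := Submodule.smul_mono le_rfl h1 hv
    rw [LinearMap.range_eq_map, ← Submodule.map_smul''] at h2
    obtain ⟨z, hz, hzv⟩ := h2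
    rwa [hx hzv] at hz
  | succ k ih =>
    intro a M _ _ _ hM b
    obtain ⟨α, hα⟩ := ENat.ne_top_iff_exists.mp
      (length_quotient_ne_top_of_pow_le (le_refl (maximalIdeal S ^ a)))
    obtain ⟨r, hr⟩ := exists_pow_le_of_card_le (S := S) α (k + 1)
    obtain ⟨t, h, htm, htP, htA⟩ := exists_parameters_notMem_associatedPrimes (by omega) hM r
    obtain ⟨a', ha'⟩ := hr h
    have hi : ∀ i < r, ∃ N : ℕ, ∀ x ∈ {x : S | ∃ y : Fin k → S, (∀ i, y i ∈ maximalIdeal S) ∧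
          maximalIdeal S ^ a' ≤ Ideal.span {x} ⊔ Ideal.span (Set.range y) ⊔
            (Module.annihilator S M ⊔ Ideal.span {t i})},
        ∀ v : M, x • v ∈ maximalIdeal S ^ N • (⊤ : Submodule S M) →
          v ∈ maximalIdeal S ^ b • (⊤ : Submodule S M) := by
      intro i hi
      obtain ⟨N', htN', hassN', hN'⟩ := exists_quotient_equidimensional hM (htm i) (htP i hi)
      refine hN' _ (fun b => ?_) b
      obtain ⟨N, hN⟩ := ih a' (M ⧸ N') hassN' b
      refine ⟨N, ?_⟩
      rintro x ⟨y, hym, hy⟩ v hv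
      rw [← Submodule.mkQ_mem_pow_smul_top_iff]
      refine hN x ⟨y, hym, hy.trans (sup_le_sup_left (sup_le ?_ ?_) _)⟩ _ ?_
      · exact LinearMap.annihilator_le_of_surjective _ N'.mkQ_surjective
      · exact (Ideal.span_singleton_le_iff_mem _).mpr htN'
      · rw [← map_smul, Submodule.mkQ_mem_pow_smul_top_iff]
        exact Submodule.mem_sup_right hv
    choose! N hN using hi
    refine ⟨(Finset.range r).sup N, ?_⟩
    rintro x ⟨y, hym, hy⟩ v hv
    obtain ⟨i, hir, hi⟩ := ha'
      (Ideal.span {x} ⊔ Ideal.span (Set.range (Fin.tail y)) ⊔ Module.annihilator S M)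
      (fun n => by
        have hle : maximalIdeal S ^ a ≤ (Ideal.span {x} ⊔ Ideal.span (Set.range (Fin.tail y)) ⊔
            Module.annihilator S M) ⊔ Ideal.span {y 0} := by
          refine hy.trans (sup_le (sup_le ?_ ?_) ?_)
          · exact le_sup_of_le_left (le_sup_of_le_left le_sup_left)
          · rw [Ideal.span_le]
            rintro _ ⟨i, rfl⟩
            refine Fin.cases ?_ (fun i => ?_) i
            · exact Ideal.mem_sup_right (Ideal.mem_span_singleton_self _)
            · exact Ideal.mem_sup_left (Ideal.mem_sup_left (Ideal.mem_sup_right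
                (Ideal.subset_span ⟨i, rfl⟩)))
          · exact le_sup_of_le_left le_sup_right
        have := length_quotient_sup_pow_le (hym 0) hle n
        rwa [← hα] at this)
      (Finset.range r)
      (fun i => Ideal.span {x} ⊔ Ideal.span (Set.range (Fin.tail y)) ⊔
        (Module.annihilator S M ⊔ Ideal.span {t i}))
      (by simp) (fun i _ => sup_le_sup_left le_sup_left _)
      (fun A hA hc => by
        obtain ⟨j, hj⟩ := Finset.card_pos.mp (by omega : 0 < A.card)
        have hle : ∀ i ∈ A, Ideal.span {x} ⊔ Ideal.span (Set.range (Fin.tail y)) ⊔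
            (Module.annihilator S M ⊔ Ideal.span {t i}) ≤ A.sup fun i => Ideal.span {x} ⊔
              Ideal.span (Set.range (Fin.tail y)) ⊔ (Module.annihilator S M ⊔ Ideal.span {t i}) :=
          fun i hi => Finset.le_sup (f := fun i => Ideal.span {x} ⊔
            Ideal.span (Set.range (Fin.tail y)) ⊔ (Module.annihilator S M ⊔ Ideal.span {t i})) hi
        refine (htA A hA hc).trans (sup_le ?_ ?_)
        · refine le_trans ?_ (hle j hj)
          exact le_sup_of_le_right le_sup_left
        · rw [Ideal.span_le]
          rintro _ ⟨i, hi, rfl⟩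
          refine hle i hi ?_
          exact Ideal.mem_sup_right (Ideal.mem_sup_right (Ideal.mem_span_singleton_self _)))
    refine hN i (Finset.mem_range.mp hir) x ⟨Fin.tail y, fun i => hym _, hi⟩ v ?_
    exact Submodule.smul_mono_left (Ideal.pow_le_pow_right (Finset.le_sup hir)) hv

end Uniform

section Completion

namespace AdicCompletion

variable {R : Type*} [CommRing R] [IsLocalRing R] [IsNoetherianRing R]

theorem mem_maximalIdeal_pow_iff {n : ℕ} {x : AdicCompletion (maximalIdeal R) R} :
    x ∈ maximalIdeal (AdicCompletion (maximalIdeal R) R) ^ n ↔ evalₐ (maximalIdeal R) n x = 0 := by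
  rw [maximalIdeal_eq_map, ← Ideal.map_pow, ← Submodule.restrictScalars_mem R,
    ← Ideal.smul_top_eq_map, pow_smul_top_eq_ker_eval (maximalIdeal R).fg_of_isNoetherianRing,
    LinearMap.mem_ker]
  have h : maximalIdeal R ^ n • ⊤ ≤ maximalIdeal R ^ n := by simp
  have h' : maximalIdeal R ^ n ≤ maximalIdeal R ^ n • ⊤ := by simp
  constructor
  · intro hx
    rw [← factor_eval_eq_evalₐ _ x h, hx]
    rfl
  · intro hx
    rw [← factor_evalₐ_eq_eval _ x h', hx]
    rfl

theorem algebraMap_mem_maximalIdeal_pow_iff {n : ℕ} {r : R} :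
    algebraMap R (AdicCompletion (maximalIdeal R) R) r ∈
      maximalIdeal (AdicCompletion (maximalIdeal R) R) ^ n ↔ r ∈ maximalIdeal R ^ n := by
  rw [mem_maximalIdeal_pow_iff, AlgHom.commutes]
  exact Ideal.Quotient.eq_zero_iff_mem

theorem exists_sub_mem_maximalIdeal_pow (x : AdicCompletion (maximalIdeal R) R) (n : ℕ) :
    ∃ r : R, x - algebraMap R (AdicCompletion (maximalIdeal R) R) r ∈
      maximalIdeal (AdicCompletion (maximalIdeal R) R) ^ n := by
  obtain ⟨r, hr⟩ := Ideal.Quotient.mk_surjective (evalₐ (maximalIdeal R) n x)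
  refine ⟨r, ?_⟩
  rw [mem_maximalIdeal_pow_iff, map_sub, AlgHom.commutes, ← hr]
  exact sub_self _

omit [IsNoetherianRing R] in
theorem mem_of_algebraMap_mem_map {J : Ideal R} {n : ℕ} (hJ : maximalIdeal R ^ n ≤ J) {r : R}
    (hr : algebraMap R (AdicCompletion (maximalIdeal R) R) r ∈
      J.map (algebraMap R (AdicCompletion (maximalIdeal R) R))) : r ∈ J := by
  have h1 := Ideal.mem_map_of_mem (evalₐ (maximalIdeal R) n).toRingHom hr
  have h2 : (evalₐ (maximalIdeal R) n).toRingHom.comp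
      (algebraMap R (AdicCompletion (maximalIdeal R) R)) = Ideal.Quotient.mk (maximalIdeal R ^ n) :=
    (evalₐ (maximalIdeal R) n).comp_algebraMap
  rw [Ideal.map_map, h2, ← RingHom.comp_apply, h2] at h1
  rwa [← Ideal.mem_comap, Ideal.comap_map_mk hJ] at h1

theorem maximalIdeal_pow_eq_map (n : ℕ) :
    maximalIdeal (AdicCompletion (maximalIdeal R) R) ^ n =
      (maximalIdeal R ^ n).map (algebraMap R (AdicCompletion (maximalIdeal R) R)) := by
  rw [maximalIdeal_eq_map, Ideal.map_pow]

end AdicCompletion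

end Completion

section Parameters

variable {S : Type*} [CommRing S] [IsLocalRing S] [IsNoetherianRing S]

theorem exists_fin_parameters (I : Ideal S) (d : ℕ)
    (hI : ∀ Q : PrimeSpectrum S, I ≤ Q.asIdeal → Order.coheight Q ≤ d) :
    ∃ y : Fin d → S, (∀ i, y i ∈ maximalIdeal S) ∧
      ∃ h, maximalIdeal S ^ h ≤ I ⊔ Ideal.span (Set.range y) := by
  obtain ⟨t, htm, ht⟩ := exists_parameters I d hI d
  refine ⟨fun i => t i, fun i => htm i, exists_maximalIdeal_pow_le fun Q hQ => ?_⟩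
  have himg : t '' (Finset.range d : Finset ℕ) = Set.range fun i : Fin d => t i := by
    ext s
    simp only [Finset.coe_range, Set.mem_image, Set.mem_Iio, Set.mem_range]
    exact ⟨fun ⟨i, hi, h⟩ => ⟨⟨i, hi⟩, h⟩, fun ⟨i, h⟩ => ⟨i, i.2, h⟩⟩
  rcases ht _ subset_rfl Q (by rwa [himg]) with h | h
  · exact h
  · rw [Finset.card_range] at h
    refine eq_closedPoint_of_coheight_le_zero ?_
    have hfin : (d : ℕ∞) ≠ ⊤ := ENat.natCast_ne_top d
    exact (ENat.add_le_add_iff_right hfin).mp (by simpa using h)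

theorem ringKrullDim_le_of_pow_le_span {d h : ℕ} {y : Fin d → S} (hy : ∀ i, y i ∈ maximalIdeal S)
    (hle : maximalIdeal S ^ h ≤ Ideal.span (Set.range y)) : ringKrullDim S ≤ d := by
  classical
  rw [← maximalIdeal_height_eq_ringKrullDim]
  have hmin : maximalIdeal S ∈ (Ideal.span (Set.range y)).minimalPrimes := by
    refine ⟨⟨inferInstance, Ideal.span_le.mpr (by rintro _ ⟨i, rfl⟩; exact hy i)⟩, ?_⟩
    rintro Q ⟨hQ, hyQ⟩ -
    exact hQ.le_of_pow_le (hle.trans hyQ)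
  have hrange : Set.range y = ((Finset.univ.image y : Finset S) : Set S) := by simp
  rw [hrange] at hmin
  have h1 := Ideal.height_le_card_of_mem_minimalPrimes_span_finset hmin
  have h2 : (Finset.univ.image y).card ≤ d := Finset.card_image_le.trans (by simp)
  exact_mod_cast h1.trans (Nat.cast_le.mpr h2)

end Parameters

section Dimension

variable {R : Type*} [CommRing R] [IsLocalRing R] [IsNoetherianRing R]

theorem AdicCompletion.ringKrullDim_le {d : ℕ} (hd : ringKrullDim R ≤ d) :
    ringKrullDim (AdicCompletion (maximalIdeal R) R) ≤ d := by
  have := AdicCompletion.isNoetherianRing_of_isNoetherianRing (maximalIdeal R)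
  obtain ⟨y, hym, h, hy⟩ := exists_fin_parameters (⊥ : Ideal R) d fun Q _ => by
    have := (Order.coheight_le_krullDim Q).trans hd
    exact_mod_cast this
  refine ringKrullDim_le_of_pow_le_span (h := h)
    (y := fun i => algebraMap R (AdicCompletion (maximalIdeal R) R) (y i)) (fun i => ?_) ?_
  · rw [maximalIdeal_eq_map]
    exact Ideal.mem_map_of_mem _ (hym i)
  · rw [maximalIdeal_pow_eq_map]
    refine (Ideal.map_mono hy).trans ?_
    rw [bot_sup_eq, Ideal.map_span, ← Set.range_comp]
    rfl

end Dimension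

section Order

variable {R : Type*} [CommRing R] [IsLocalRing R]

theorem ordR_lt_of_notMem {x : R} {n : ℕ} (hx : x ∉ maximalIdeal R ^ n) : ordR R x < n := by
  have hb : ∀ k ∈ {k : ℕ | x ∈ maximalIdeal R ^ k}, k < n := fun k hk => by
    by_contra! h
    exact hx (Ideal.pow_le_pow_right h hk)
  exact hb _ (Nat.sSup_mem ⟨0, by simp⟩ ⟨n, fun k hk => (hb k hk).le⟩)

theorem le_ordR [IsNoetherianRing R] {x : R} (hx : x ≠ 0) {n : ℕ} (hn : x ∈ maximalIdeal R ^ n) :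
    n ≤ ordR R x := by
  have hinf := Ideal.iInf_pow_eq_bot_of_isLocalRing (maximalIdeal R)
    (Ideal.IsPrime.ne_top inferInstance)
  have hx' : x ∉ ⨅ i, maximalIdeal R ^ i := by rwa [hinf, Ideal.mem_bot]
  rw [Ideal.mem_iInf] at hx'
  push Not at hx'
  obtain ⟨k, hk⟩ := hx'
  refine le_csSup ⟨k, fun j hj => ?_⟩ hn
  by_contra! h
  exact hk (Ideal.pow_le_pow_right h.le hj)

end Order

section Degree

variable {R : Type u} [CommRing R]

theorem modLength_eq_length (M : Type u) [AddCommGroup M] [Module R M] :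
    modLength R M = Module.length R M :=
  (Module.coe_length R M).symm

variable [IsLocalRing R]

theorem exists_pow_le_of_rdeg_eq [IsNoetherianRing R] {d a : ℕ} {x : R}
    (hx : rdeg R d x = (a : WithBot ℕ∞)) :
    ∃ y : Fin (d - 1) → R, (∀ i, y i ∈ maximalIdeal R) ∧
      maximalIdeal R ^ (a + 1) ≤ Ideal.span {x} ⊔ Ideal.span (Set.range y) := by
  by_cases hu : IsUnit x
  · refine ⟨0, by simp, ?_⟩
    rw [Ideal.span_singleton_eq_top.mpr hu, top_sup_eq]
    exact le_top
  · have : Nonempty {y : Fin (d - 1) → R // ∀ i, y i ∈ maximalIdeal R} := ⟨⟨0, by simp⟩⟩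
    rw [rdeg, if_neg hu] at hx
    obtain ⟨⟨y, hym⟩, hy⟩ := ciInf_mem
      (fun y : {y : Fin (d - 1) → R // ∀ i, y i ∈ maximalIdeal R} =>
        modLength R (R ⧸ Ideal.span ({x} ∪ Set.range y.1)))
    rw [hx] at hy
    simp only [modLength_eq_length] at hy
    refine ⟨y, hym, ?_⟩
    rw [← Ideal.span_union]
    by_contra hle
    have h1 := (le_length_quotient_sup_pow hle).trans (length_quotient_anti le_sup_left)
    have h2 : Module.length R (R ⧸ Ideal.span ({x} ∪ Set.range y)) = (a : ℕ∞) := by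
      exact_mod_cast hy
    rw [h2] at h1
    have := Nat.cast_le.mp h1
    omega

theorem rdeg_le_of_pow_le [IsNoetherianRing R] {d h A : ℕ}
    (hA : Module.length R (R ⧸ maximalIdeal R ^ h) = A) {x : R} {y : Fin (d - 1) → R}
    (hym : ∀ i, y i ∈ maximalIdeal R)
    (hy : maximalIdeal R ^ h ≤ Ideal.span {x} ⊔ Ideal.span (Set.range y)) :
    ∃ a ≤ A, rdeg R d x = (a : WithBot ℕ∞) := by
  by_cases hu : IsUnit x
  · exact ⟨0, Nat.zero_le _, by simp [rdeg, hu]⟩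
  · have : Nonempty {y : Fin (d - 1) → R // ∀ i, y i ∈ maximalIdeal R} := ⟨⟨y, hym⟩⟩
    rw [rdeg, if_neg hu]
    have hle : (⨅ y : {y : Fin (d - 1) → R // ∀ i, y i ∈ maximalIdeal R},
        modLength R (R ⧸ Ideal.span ({x} ∪ Set.range y.1))) ≤ (A : WithBot ℕ∞) := by
      refine (iInf_le _ ⟨y, hym⟩).trans ?_
      rw [modLength_eq_length, Ideal.span_union]
      have := (length_quotient_anti hy).trans_eq hA
      exact_mod_cast this
    obtain ⟨z, hz⟩ := ciInf_mem
      (fun y : {y : Fin (d - 1) → R // ∀ i, y i ∈ maximalIdeal R} =>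
        modLength R (R ⧸ Ideal.span ({x} ∪ Set.range y.1)))
    rw [← hz] at hle ⊢
    simp only [modLength_eq_length] at hle ⊢
    have hle' : Module.length R (R ⧸ Ideal.span ({x} ∪ Set.range z.1)) ≤ (A : ℕ∞) := by
      exact_mod_cast hle
    obtain ⟨a, ha⟩ := ENat.ne_top_iff_exists.mp (ne_top_of_le_ne_top (ENat.natCast_ne_top A) hle')
    rw [← ha] at hle' ⊢
    exact ⟨a, Nat.cast_le.mp hle', rfl⟩

end Degree

section UniformBound

variable {R : Type u} [CommRing R] [IsLocalRing R] [IsNoetherianRing R]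

theorem exists_uniform_bound_of_unmixed {d : ℕ} (hd1 : 1 ≤ d)
    (hP : ∀ P ∈ associatedPrimes (AdicCompletion (maximalIdeal R) R)
        (AdicCompletion (maximalIdeal R) R),
      ringKrullDim ((AdicCompletion (maximalIdeal R) R) ⧸ P) = (d : WithBot ℕ∞)) :
    ∃ χ : ℕ → ℕ → ℕ, ∀ (x y : R) (a : ℕ), rdeg R d x = (a : WithBot ℕ∞) → y ≠ 0 →
      x * y ≠ 0 ∧ ordR R (x * y) ≤ χ a (ordR R y) := by
  have := AdicCompletion.isNoetherianRing_of_isNoetherianRing (maximalIdeal R)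
  let S := AdicCompletion (maximalIdeal R) R
  have key := exists_uniform_chevalley (S := S) (d - 1)
  choose N hN using fun a => key a S fun P hPS => by
    have := hP P.asIdeal hPS
    rw [ringKrullDim_quotient_eq_coheight] at this
    rw [Nat.sub_add_cancel hd1]
    exact_mod_cast this
  refine ⟨fun a b => N (a + 1) (b + 1), fun x y a hx hy => ?_⟩
  obtain ⟨z, hzm, hz⟩ := exists_pow_le_of_rdeg_eq hx
  have hmem : x * y ∉ maximalIdeal R ^ N (a + 1) (ordR R y + 1) := by
    intro hxy
    have h1 := hN (a + 1) (ordR R y + 1) (algebraMap R S x)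
      ⟨fun i => algebraMap R S (z i), fun i => ?_, le_sup_of_le_left ?_⟩ (algebraMap R S y) ?_
    · rw [smul_eq_mul, Ideal.mul_top, AdicCompletion.algebraMap_mem_maximalIdeal_pow_iff] at h1
      exact (Nat.lt_irrefl _) (le_ordR hy h1)
    · rw [AdicCompletion.maximalIdeal_eq_map]
      exact Ideal.mem_map_of_mem _ (hzm i)
    · rw [AdicCompletion.maximalIdeal_pow_eq_map]
      refine (Ideal.map_mono hz).trans ?_
      rw [Ideal.map_sup, Ideal.map_span, Ideal.map_span, ← Set.range_comp, Set.image_singleton]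
      rfl
    · rw [smul_eq_mul, smul_eq_mul, Ideal.mul_top, ← map_mul,
        AdicCompletion.algebraMap_mem_maximalIdeal_pow_iff]
      exact hxy
  exact ⟨fun h => hmem (h ▸ zero_mem _), (ordR_lt_of_notMem hmem).le⟩

end UniformBound

section Converse

theorem exists_mem_forall_coheight_le {S : Type*} [CommRing S] [IsNoetherianRing S] {k : ℕ}
    (hS : ∀ Q : PrimeSpectrum S, Order.coheight Q ≤ (k + 1 : ℕ)) {P : PrimeSpectrum S}
    (hP : Order.coheight P ≠ (k + 1 : ℕ)) :
    ∃ x ∈ P.asIdeal, ∀ Q : PrimeSpectrum S, x ∈ Q.asIdeal → Order.coheight Q ≤ k := by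
  have hfin : {Q : PrimeSpectrum S | Order.coheight Q = (k + 1 : ℕ)}.Finite := by
    refine Set.Finite.of_finite_image (f := PrimeSpectrum.asIdeal)
      ((minimalPrimes.finite_of_isNoetherianRing S).subset ?_)
      (fun _ _ _ _ h => PrimeSpectrum.ext h)
    rintro _ ⟨Q, hQ, rfl⟩
    refine ⟨⟨Q.2, bot_le⟩, fun Q' hQ' hle => ?_⟩
    by_contra hlt
    have h1 := Order.coheight_add_one_le (a := Q) (b := ⟨Q', hQ'.1⟩) ⟨hle, hlt⟩
    rw [Set.mem_ofPred_eq.mp hQ] at h1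
    have h2 := h1.trans (hS _)
    norm_cast at h2
    omega
  have hnot : ¬ ((P.asIdeal : Set S) ⊆
      ⋃ Q ∈ {Q : PrimeSpectrum S | Order.coheight Q = (k + 1 : ℕ)}, (Q.asIdeal : Set S)) := by
    rw [Ideal.subset_union_prime_finite hfin P P fun Q _ _ _ => Q.2]
    rintro ⟨Q, hQ, hle⟩
    refine hP (le_antisymm (hS P) ?_)
    rw [← Set.mem_ofPred_eq.mp hQ]
    exact Order.coheight_anti hle
  obtain ⟨x, hxP, hx⟩ := Set.not_subset.mp hnot
  refine ⟨x, hxP, fun Q hxQ => ?_⟩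
  have hne : Order.coheight Q ≠ (k + 1 : ℕ) := fun h =>
    hx (Set.mem_biUnion (show Q ∈ {Q | Order.coheight Q = (k + 1 : ℕ)} from h) hxQ)
  have hlt := lt_of_le_of_ne (hS Q) hne
  push_cast at hlt
  exact Order.le_of_lt_add_one hlt

variable {R : Type u} [CommRing R] [IsLocalRing R] [IsNoetherianRing R]

theorem AdicCompletion.pow_le_of_sub_mem {h : ℕ} {ι : Type*}
    {x : ι → AdicCompletion (maximalIdeal R) R}
    (hx : maximalIdeal (AdicCompletion (maximalIdeal R) R) ^ h ≤ Ideal.span (Set.range x))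
    {r : ι → R} (hr : ∀ i, x i - algebraMap R _ (r i) ∈
      maximalIdeal (AdicCompletion (maximalIdeal R) R) ^ (h + 1)) :
    maximalIdeal R ^ h ≤ Ideal.span (Set.range r) := by
  refine Submodule.le_of_le_smul_of_le_jacobson_bot (I := maximalIdeal R)
    (IsNoetherian.noetherian _) (maximalIdeal_le_jacobson _) ?_
  rw [smul_eq_mul, ← pow_succ']
  intro s hs
  refine mem_of_algebraMap_mem_map (n := h + 1) le_sup_right ?_
  have hs' := hx (algebraMap_mem_maximalIdeal_pow_iff.mpr hs)
  refine (Ideal.span_le.mpr ?_ : Ideal.span (Set.range x) ≤ _) hs'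
  rintro _ ⟨i, rfl⟩
  rw [SetLike.mem_coe, ← sub_add_cancel (x i) (algebraMap R _ (r i))]
  refine add_mem ?_ ?_
  · rw [Ideal.map_sup, ← maximalIdeal_pow_eq_map]
    exact Ideal.mem_sup_right (hr i)
  · exact Ideal.mem_map_of_mem _ (Ideal.mem_sup_left (Ideal.subset_span ⟨i, rfl⟩))

theorem unmixed_of_uniform_bound {d : ℕ} (hd1 : 1 ≤ d) (hd : ringKrullDim R ≤ d)
    {χ : ℕ → ℕ → ℕ} (hχ : ∀ (x y : R) (a : ℕ), rdeg R d x = (a : WithBot ℕ∞) → y ≠ 0 →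
      x * y ≠ 0 ∧ ordR R (x * y) ≤ χ a (ordR R y))
    (P : Ideal (AdicCompletion (maximalIdeal R) R))
    (hP : P ∈ associatedPrimes (AdicCompletion (maximalIdeal R) R)
      (AdicCompletion (maximalIdeal R) R)) :
    ringKrullDim ((AdicCompletion (maximalIdeal R) R) ⧸ P) = (d : WithBot ℕ∞) := by
  have := AdicCompletion.isNoetherianRing_of_isNoetherianRing (maximalIdeal R)
  obtain ⟨k, rfl⟩ := Nat.exists_eq_add_of_le' hd1
  let S := AdicCompletion (maximalIdeal R) R
  by_contra hne
  have hPprime : P.IsPrime := hP.1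
  have hdim : ∀ Q : PrimeSpectrum S, Order.coheight Q ≤ (k + 1 : ℕ) := fun Q => by
    have := (Order.coheight_le_krullDim Q).trans (AdicCompletion.ringKrullDim_le hd)
    exact_mod_cast this
  obtain ⟨x, hxP, hx⟩ := exists_mem_forall_coheight_le hdim (P := ⟨P, hPprime⟩) fun h => hne (by
    rw [ringKrullDim_quotient_eq_coheight ⟨P, hPprime⟩, h]
    rfl)
  obtain ⟨y, hym, h, hy⟩ := exists_fin_parameters (Ideal.span {x}) k fun Q hQ =>
    hx Q ((Ideal.span_singleton_le_iff_mem _).mp hQ)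
  obtain ⟨-, z, hz⟩ := isAssociatedPrime_iff.mp hP
  have hxz : x * z = 0 := by
    have h1 : x ∈ P := hxP
    rw [hz] at h1
    simpa [Submodule.mem_colon_singleton] using h1
  have hz0 : z ≠ 0 := by
    rintro rfl
    refine hPprime.ne_top ?_
    rw [hz]
    ext
    simp
  obtain ⟨b, hb⟩ : ∃ b, z ∉ maximalIdeal S ^ b := by
    by_contra! hb
    have h1 := Ideal.iInf_pow_eq_bot_of_isLocalRing (maximalIdeal S)
      (Ideal.IsPrime.ne_top inferInstance)
    exact hz0 (by simpa [h1] using Ideal.mem_iInf.mpr hb)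
  obtain ⟨A, hA⟩ := ENat.ne_top_iff_exists.mp
    (length_quotient_ne_top_of_pow_le (le_refl (maximalIdeal R ^ h)))
  obtain ⟨B, hB⟩ : ∃ B, ∀ a ≤ A, ∀ b' ≤ b, χ a b' ≤ B :=
    ⟨(Finset.range (A + 1)).sup fun a => (Finset.range (b + 1)).sup fun b' => χ a b',
      fun a ha b' hb' =>
        (Finset.le_sup (f := fun b' => χ a b') (Finset.mem_range.mpr (Nat.lt_succ_of_le hb'))).trans
        (Finset.le_sup (f := fun a => (Finset.range (b + 1)).sup fun b' => χ a b')
          (Finset.mem_range.mpr (Nat.lt_succ_of_le ha)))⟩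
  let n := max (h + 1) (max b (B + 1))
  obtain ⟨x', hx'⟩ := AdicCompletion.exists_sub_mem_maximalIdeal_pow x n
  choose y' hy' using fun i => AdicCompletion.exists_sub_mem_maximalIdeal_pow (y i) n
  obtain ⟨z', hz'⟩ := AdicCompletion.exists_sub_mem_maximalIdeal_pow z n
  have hym' : ∀ i, y' i ∈ maximalIdeal R := fun i => by
    have h1 : algebraMap R S (y' i) ∈ maximalIdeal S := by
      rw [← sub_sub_cancel (y i) (algebraMap R S (y' i))]
      exact sub_mem (hym i) (Ideal.pow_le_self (by omega) (hy' i))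
    rw [← pow_one (maximalIdeal S)] at h1
    simpa using AdicCompletion.algebraMap_mem_maximalIdeal_pow_iff.mp h1
  have hspan : maximalIdeal R ^ h ≤ Ideal.span {x'} ⊔ Ideal.span (Set.range y') := by
    have h1 := AdicCompletion.pow_le_of_sub_mem (h := h)
      (x := fun o : Option (Fin k) => o.elim x y) (r := fun o => o.elim x' y') ?_ ?_
    · refine h1.trans (Ideal.span_le.mpr ?_)
      rintro _ ⟨_ | i, rfl⟩
      · exact Ideal.mem_sup_left (Ideal.mem_span_singleton_self _)
      · exact Ideal.mem_sup_right (Ideal.subset_span ⟨i, rfl⟩)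
    · refine hy.trans (sup_le ?_ ?_)
      · exact (Ideal.span_singleton_le_iff_mem _).mpr (Ideal.subset_span ⟨none, rfl⟩)
      · refine Ideal.span_mono ?_
        rintro _ ⟨i, rfl⟩
        exact ⟨some i, rfl⟩
    · rintro (_ | i)
      · exact Ideal.pow_le_pow_right (le_max_left _ _) hx'
      · exact Ideal.pow_le_pow_right (le_max_left _ _) (hy' i)
  obtain ⟨a, haA, ha⟩ := rdeg_le_of_pow_le (d := k + 1) hA.symm hym' hspan
  have hzb : z' ∉ maximalIdeal R ^ b := fun hmem => hb (by
    rw [← sub_add_cancel z (algebraMap R S z')]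
    exact add_mem (Ideal.pow_le_pow_right (by omega) hz')
      (AdicCompletion.algebraMap_mem_maximalIdeal_pow_iff.mpr hmem))
  obtain ⟨hne0, hord⟩ := hχ x' z' a ha (fun h0 => hzb (h0 ▸ zero_mem _))
  have hmem : x' * z' ∈ maximalIdeal R ^ n := by
    rw [← AdicCompletion.algebraMap_mem_maximalIdeal_pow_iff, map_mul,
      show algebraMap R S x' * algebraMap R S z' =
        -(x - algebraMap R S x') * algebraMap R S z' - x * (z - algebraMap R S z') by
          linear_combination hxz]
    exact sub_mem (Ideal.mul_mem_right _ _ (neg_mem hx')) (Ideal.mul_mem_left _ _ hz')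
  have h1 := le_ordR hne0 hmem
  have h2 := hB a haA _ (ordR_lt_of_notMem hzb).le
  omega

end Converse

theorem unmixed_iff_uniform_bound
    (R : Type u) [CommRing R] [IsLocalRing R] [IsNoetherianRing R] (d : ℕ)
    (hd1 : 1 ≤ d) (hd : ringKrullDim R = (d : WithBot ℕ∞)) :
    (∀ P ∈ associatedPrimes (AdicCompletion (IsLocalRing.maximalIdeal R) R)
        (AdicCompletion (IsLocalRing.maximalIdeal R) R),
      ringKrullDim ((AdicCompletion (IsLocalRing.maximalIdeal R) R) ⧸ P)
        = (d : WithBot ℕ∞)) ↔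
    ∃ χ : ℕ → ℕ → ℕ, ∀ (x y : R) (a : ℕ),
      rdeg R d x = (a : WithBot ℕ∞) → y ≠ 0 →
      x * y ≠ 0 ∧ ordR R (x * y) ≤ χ a (ordR R y) :=
  ⟨exists_uniform_bound_of_unmixed hd1,
    fun ⟨_, hχ⟩ => unmixed_of_uniform_bound hd1 hd.le hχ⟩
end

section
/- Let (R, m) be a Noetherian local ring of Krull dimension d ≥ 1. Then R is Cohen–Macaulay (i.e., some, equivalently every, system of parameters of R is an R-regular sequence) if and only if there exists a function δ : ℕ × ℕ → ℕ with the following property: for every system of parameters x_1, …, x_d of R (a d-tuple generating an m-primary ideal) and every d-tuple y_1, …, y_d of elements of R, if the length of R/(x_1, …, x_d)R is at most a and y_d ∉ (x_1, …, x_{d−1})R + m^{b+1}, then x_1y_1 + ⋯ + x_dy_d ∉ m^{δ(a,b)+1}. -/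
/-!
STATEMENT 18: A Noetherian local ring `(R, m)` of Krull dimension `d ≥ 1` is
Cohen–Macaulay (every system of parameters is a regular sequence) iff there is a
function `δ : ℕ × ℕ → ℕ` such that for every system of parameters `x₁, …, x_d` and
every `d`-tuple `y₁, …, y_d`: if `R/(x₁, …, x_d)` has length `≤ a` and
`y_d ∉ (x₁, …, x_{d−1}) + m^{b+1}`, then `x₁y₁ + ⋯ + x_d y_d ∉ m^{δ(a,b)+1}`.
-/

universe u

open IsLocalRing

section LocalRing

variable {R : Type u} [CommRing R] [IsLocalRing R] [IsNoetherianRing R]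

theorem maximalIdeal_pow_smul_top_eq_bot {M : Type u} [AddCommGroup M] [Module R M]
    [Module.Finite R M] {a : ℕ} (h : modLength R M ≤ (a : WithBot ℕ∞)) :
    maximalIdeal R ^ a • (⊤ : Submodule R M) = ⊥ := by
  by_contra hne
  have step (i : ℕ) (hi : i ≤ a) :
      maximalIdeal R ^ (i + 1) • (⊤ : Submodule R M) < maximalIdeal R ^ i • ⊤ := by
    refine lt_of_le_of_ne (Submodule.smul_mono_left (Ideal.pow_le_pow_right i.le_succ)) fun h ↦ ?_
    have hbot : maximalIdeal R ^ i • (⊤ : Submodule R M) = ⊥ := by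
      refine Submodule.eq_bot_of_le_smul_of_le_jacobson_bot (maximalIdeal R) _
        (IsNoetherian.noetherian _) ?_ (maximalIdeal_le_jacobson _)
      rw [← Submodule.mul_smul, ← pow_succ', h]
    exact hne (eq_bot_iff.mpr
      ((Submodule.smul_mono_left (Ideal.pow_le_pow_right hi)).trans hbot.le))
  let s : LTSeries (Submodule R M) := LTSeries.mk (a + 1)
    (fun i ↦ maximalIdeal R ^ (a + 1 - (i : ℕ)) • ⊤) <| Fin.strictMono_iff_lt_succ.mpr fun i ↦ by
      have := step (a - i) (Nat.sub_le _ _)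
      rw [show a - (i : ℕ) + 1 = a + 1 - i by omega] at this
      simpa using this
  have hs : ((a + 1 : ℕ) : WithBot ℕ∞) ≤ a := (Order.LTSeries.length_le_krullDim s).trans h
  have : a + 1 ≤ a := by exact_mod_cast hs
  omega

theorem maximalIdeal_pow_le_of_modLength_le {I : Ideal R} {a : ℕ}
    (h : modLength R (R ⧸ I) ≤ (a : WithBot ℕ∞)) : maximalIdeal R ^ a ≤ I := by
  intro r hr
  have hmem : r • (Ideal.Quotient.mk I 1) ∈ maximalIdeal R ^ a • (⊤ : Submodule R (R ⧸ I)) :=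
    Submodule.smul_mem_smul hr trivial
  rw [maximalIdeal_pow_smul_top_eq_bot h, Submodule.mem_bot] at hmem
  exact Ideal.Quotient.eq_zero_iff_mem.mp (by simpa [Algebra.smul_def] using hmem)

theorem exists_modLength_le_of_ne_top {R M : Type u} [CommRing R] [AddCommGroup M] [Module R M]
    (h : modLength R M ≠ ⊤) : ∃ a : ℕ, modLength R M ≤ (a : WithBot ℕ∞) := by
  rw [modLength, ← Module.coe_length] at h ⊢
  obtain ⟨a, ha⟩ := ENat.ne_top_iff_exists.mp fun h' : Module.length R M = ⊤ ↦ h (by rw [h']; rfl)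
  exact ⟨a, by rw [← ha]; rfl⟩

theorem modLength_quotient_ne_top {I : Ideal R} {n : ℕ} (h : maximalIdeal R ^ n ≤ I) :
    modLength R (R ⧸ I) ≠ ⊤ := by
  have : IsArtinian R (R ⧸ I) := by
    by_cases hI : I = ⊤
    · subst hI
      infer_instance
    have : Nontrivial (R ⧸ I) := Ideal.Quotient.nontrivial_iff.mpr hI
    have : IsLocalRing (R ⧸ I) :=
      .of_surjective' (Ideal.Quotient.mk I) Ideal.Quotient.mk_surjective
    have : IsArtinianRing (R ⧸ I) := by
      rw [isArtinianRing_iff_isNilpotent_maximalIdeal]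
      refine ⟨n, ?_⟩
      rw [← map_maximalIdeal_of_surjective _ (Ideal.Quotient.mk_surjective (I := I)),
        ← Ideal.map_pow, Ideal.zero_eq_bot, Ideal.map_eq_bot_iff_le_ker, Ideal.mk_ker]
      exact h
    exact isArtinian_of_surjective_algebraMap (Ideal.Quotient.mk_surjective (I := I))
  rw [modLength, ← Module.coe_length]
  intro h'
  exact Module.length_ne_top (R := R) (M := R ⧸ I) (WithBot.coe_injective h')

theorem modLength_quotient_ne_top_of_le_radical {I J : Ideal R}
    (hI : modLength R (R ⧸ I) ≠ ⊤) (h : I ≤ J.radical) : modLength R (R ⧸ J) ≠ ⊤ := by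
  obtain ⟨a, ha⟩ := exists_modLength_le_of_ne_top hI
  obtain ⟨k, hk⟩ := Ideal.exists_pow_le_of_le_radical_of_fg
    ((maximalIdeal_pow_le_of_modLength_le ha).trans h) (IsNoetherian.noetherian _)
  rw [← pow_mul] at hk
  exact modLength_quotient_ne_top hk

theorem mem_of_forall_mem_sup_maximalIdeal_pow {I : Ideal R} {r : R}
    (h : ∀ n : ℕ, r ∈ I ⊔ maximalIdeal R ^ (n + 1)) : r ∈ I := by
  have hbot := Ideal.iInf_pow_smul_eq_bot_of_isLocalRing (M := R ⧸ I) (maximalIdeal R)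
    (maximalIdeal.isMaximal R).ne_top
  rw [← Ideal.Quotient.eq_zero_iff_mem, ← Submodule.mem_bot R, ← hbot, Submodule.mem_iInf]
  intro n
  obtain ⟨s, hs, t, ht, rfl⟩ := Submodule.mem_sup.mp (h n)
  have hmem : t • (Ideal.Quotient.mk I 1) ∈ maximalIdeal R ^ n • (⊤ : Submodule R (R ⧸ I)) :=
    Submodule.smul_mem_smul (Ideal.pow_le_pow_right n.le_succ ht) trivial
  simpa [Algebra.smul_def, Ideal.Quotient.eq_zero_iff_mem.mpr hs] using hmem

end LocalRing

theorem ofList_take_ofFn {R : Type*} [CommRing R] {d : ℕ} (x : Fin d → R) (i : ℕ) :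
    Ideal.ofList ((List.ofFn x).take i) = Ideal.span (x '' {j : Fin d | (j : ℕ) < i}) := by
  rw [Ideal.ofList]
  congr 1
  ext r
  simp only [Set.mem_ofPred_eq, Set.mem_image, List.mem_take_iff_getElem, List.length_ofFn,
    List.getElem_ofFn, lt_min_iff]
  exact ⟨fun ⟨j, hj, h⟩ ↦ ⟨⟨j, hj.2⟩, hj.1, h⟩, fun ⟨j, hj, h⟩ ↦ ⟨j, ⟨hj, j.2⟩, h⟩⟩

theorem isRegular_ofFn_iff {R : Type*} [CommRing R] [IsLocalRing R] {d : ℕ} {x : Fin d → R}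
    (hx : ∀ i, x i ∈ maximalIdeal R) :
    RingTheory.Sequence.IsRegular R (List.ofFn x) ↔
      ∀ (i : Fin d) (r : R), x i * r ∈ Ideal.span (x '' {j : Fin d | (j : ℕ) < i}) →
        r ∈ Ideal.span (x '' {j : Fin d | (j : ℕ) < i}) := by
  have htop : (⊤ : Ideal R) ≠ Ideal.ofList (List.ofFn x) • (⊤ : Ideal R) := by
    refine fun h ↦ (maximalIdeal.isMaximal R).ne_top (top_le_iff.mp (h.le.trans ?_))
    rw [smul_eq_mul, Ideal.mul_top, Ideal.ofList, Ideal.span_le]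
    intro r hr
    obtain ⟨i, rfl⟩ := (List.mem_ofFn' _ _).mp hr
    exact hx i
  rw [RingTheory.Sequence.isRegular_iff, and_iff_left htop,
    RingTheory.Sequence.isWeaklyRegular_iff]
  simp only [isSMulRegular_quotient_iff_mem_of_smul_mem, ofList_take_ofFn, smul_eq_mul,
    Ideal.mul_top, List.getElem_ofFn, List.length_ofFn, Fin.forall_iff]

section UniformBound

variable {R : Type u} [CommRing R] [IsLocalRing R] [IsNoetherianRing R]

theorem sum_mul_notMem_of_isRegular {d : ℕ} {x y : Fin d → R} {a b : ℕ} (l : Fin d)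
    (hl : ∀ i, i ≠ l → (i : ℕ) < l)
    (hx : ∀ i, x i ∈ maximalIdeal R) (hreg : RingTheory.Sequence.IsRegular R (List.ofFn x))
    (ha : modLength R (R ⧸ Ideal.span (Set.range x)) ≤ (a : WithBot ℕ∞))
    (hy : y l ∉ Ideal.span (x '' {i : Fin d | (i : ℕ) < l}) ⊔ maximalIdeal R ^ (b + 1)) :
    ∑ i, x i * y i ∉ maximalIdeal R ^ (a + b + 1) := by
  intro hmem
  have hle : maximalIdeal R ^ (a + b + 1) ≤
      maximalIdeal R ^ (b + 1) * Ideal.span (Set.range x) := by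
    rw [show a + b + 1 = b + 1 + a by omega, pow_add]
    exact Ideal.mul_mono_right (maximalIdeal_pow_le_of_modLength_le ha)
  obtain ⟨z, hz, hzsum⟩ : ∃ z : Fin d → R, (∀ i, z i ∈ maximalIdeal R ^ (b + 1)) ∧
      ∑ i, z i * x i = ∑ i, x i * y i := by
    have := hle hmem
    rw [← smul_eq_mul, Ideal.span, Submodule.mem_ideal_smul_span_iff_exists_sum] at this
    obtain ⟨c, hc, hsum⟩ := this
    exact ⟨c, hc, by rw [← hsum, Finsupp.sum_fintype _ _ (by simp)]; rfl⟩
  have hdiff : x l * (y l - z l) = ∑ i ∈ Finset.univ.erase l, x i * (z i - y i) := by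
    have h0 : ∑ i, x i * (z i - y i) = 0 := by
      simp only [mul_sub, Finset.sum_sub_distrib, ← hzsum, mul_comm, sub_self]
    rw [← Finset.add_sum_erase _ _ (Finset.mem_univ l)] at h0
    linear_combination -h0
  refine hy ?_
  rw [← sub_add_cancel (y l) (z l)]
  refine Submodule.add_mem_sup ((isRegular_ofFn_iff hx).mp hreg l _ ?_) (hz l)
  rw [hdiff]
  exact Ideal.sum_mem _ fun i hi ↦ Ideal.mul_mem_right _ _
    (Ideal.subset_span ⟨i, hl i (Finset.ne_of_mem_erase hi), rfl⟩)

/-- If every member of a system of parameters is a nonzerodivisor modulo the others,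
then every system of parameters is a regular sequence. -/
theorem isRegular_of_forall_mem_span_compl {d : ℕ}
    (h : ∀ x : Fin d → R, (∀ i, x i ∈ maximalIdeal R) →
      modLength R (R ⧸ Ideal.span (Set.range x)) ≠ ⊤ →
      ∀ (i : Fin d) (r : R), x i * r ∈ Ideal.span (x '' {i}ᶜ) → r ∈ Ideal.span (x '' {i}ᶜ))
    {x : Fin d → R} (hx : ∀ i, x i ∈ maximalIdeal R)
    (hfin : modLength R (R ⧸ Ideal.span (Set.range x)) ≠ ⊤) :
    RingTheory.Sequence.IsRegular R (List.ofFn x) := by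
  refine (isRegular_ofFn_iff hx).mpr fun i r hr ↦ mem_of_forall_mem_sup_maximalIdeal_pow fun n ↦ ?_
  let z : Fin d → R := fun j ↦ if j ≤ i then x j else x j ^ (n + 1)
  have hzle {j : Fin d} (hj : j ≤ i) : z j = x j := if_pos hj
  have hzgt {j : Fin d} (hj : ¬ j ≤ i) : z j = x j ^ (n + 1) := if_neg hj
  have hz (j : Fin d) : z j ∈ maximalIdeal R := by
    by_cases hj : j ≤ i
    · exact hzle hj ▸ hx j
    · exact hzgt hj ▸ Ideal.pow_mem_of_mem _ (hx j) _ n.succ_pos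
  have hrad : Ideal.span (Set.range x) ≤ (Ideal.span (Set.range z)).radical := by
    rw [Ideal.span_le]
    rintro _ ⟨j, rfl⟩
    have hzj : z j ∈ Ideal.span (Set.range z) := Ideal.subset_span ⟨j, rfl⟩
    by_cases hj : j ≤ i
    · exact Ideal.le_radical (hzle hj ▸ hzj)
    · exact ⟨n + 1, hzgt hj ▸ hzj⟩
  have hsub : Ideal.span (x '' {j : Fin d | (j : ℕ) < i}) ≤ Ideal.span (z '' {i}ᶜ) := by
    refine Ideal.span_mono ?_
    rintro _ ⟨j, hj, rfl⟩
    have hj : j < i := hj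
    exact ⟨j, hj.ne, hzle hj.le⟩
  have hsup : Ideal.span (z '' {i}ᶜ) ≤
      Ideal.span (x '' {j : Fin d | (j : ℕ) < i}) ⊔ maximalIdeal R ^ (n + 1) := by
    rw [Ideal.span_le]
    rintro _ ⟨j, hj, rfl⟩
    by_cases hji : j ≤ i
    · exact Submodule.mem_sup_left
        (Ideal.subset_span ⟨j, lt_of_le_of_ne hji hj, (hzle hji).symm⟩)
    · exact Submodule.mem_sup_right (hzgt hji ▸ Ideal.pow_mem_pow (hx j) _)
  refine hsup (h z hz (modLength_quotient_ne_top_of_le_radical hfin hrad) i r ?_)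
  exact hzle le_rfl ▸ hsub hr

theorem mem_span_compl_of_uniform_bound {d : ℕ} (l : Fin d) (δ : ℕ → ℕ → ℕ)
    (h : ∀ (x y : Fin d → R) (a b : ℕ), (∀ i, x i ∈ maximalIdeal R) →
      modLength R (R ⧸ Ideal.span (Set.range x)) ≤ (a : WithBot ℕ∞) →
      y l ∉ Ideal.span (x '' {l}ᶜ) ⊔ maximalIdeal R ^ (b + 1) →
      ∑ i, x i * y i ∉ maximalIdeal R ^ (δ a b + 1))
    {x : Fin d → R} (hx : ∀ i, x i ∈ maximalIdeal R)
    (hfin : modLength R (R ⧸ Ideal.span (Set.range x)) ≠ ⊤) (i : Fin d) {r : R}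
    (hr : x i * r ∈ Ideal.span (x '' {i}ᶜ)) : r ∈ Ideal.span (x '' {i}ᶜ) := by
  let e : Equiv.Perm (Fin d) := Equiv.swap l i
  have hel : e l = i := Equiv.swap_apply_left _ _
  have himage : (x ∘ e) '' {l}ᶜ = x '' {i}ᶜ := by
    rw [Set.image_comp, Set.image_compl_eq e.bijective, Set.image_singleton, hel]
  obtain ⟨a, ha⟩ := exists_modLength_le_of_ne_top hfin
  refine mem_of_forall_mem_sup_maximalIdeal_pow fun b ↦ by_contra fun hb ↦ ?_
  obtain ⟨c, hc⟩ : ∃ c : Fin d → R, ∑ j ∈ Finset.univ.erase l, c j * (x ∘ e) j = x i * r := by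
    have hset : ({l}ᶜ : Set (Fin d)) = ↑(Finset.univ.erase l) := by ext; simp
    rw [← himage, hset] at hr
    exact (Submodule.mem_span_image_finset_iff_exists_fun' R).mp hr
  refine h (x ∘ e) (fun j ↦ if j = l then r else - c j) a b (fun j ↦ hx _) ?_ ?_ ?_
  · rwa [e.surjective.range_comp]
  · simpa only [himage, if_true] using hb
  · convert Ideal.zero_mem _
    rw [← Finset.add_sum_erase _ _ (Finset.mem_univ l), if_pos rfl, Function.comp_apply, hel, ← hc,
      ← Finset.sum_add_distrib]
    refine Finset.sum_eq_zero fun j hj ↦ ?_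
    rw [if_neg (Finset.ne_of_mem_erase hj)]
    ring

end UniformBound

theorem cohenMacaulay_iff_uniform_bound
    (R : Type u) [CommRing R] [IsLocalRing R] [IsNoetherianRing R] (d : ℕ)
    (hd1 : 1 ≤ d) (hd : ringKrullDim R = (d : WithBot ℕ∞)) :
    (∀ x : Fin d → R, (∀ i, x i ∈ IsLocalRing.maximalIdeal R) →
        modLength R (R ⧸ Ideal.span (Set.range x)) ≠ ⊤ →
        RingTheory.Sequence.IsRegular R (List.ofFn x)) ↔
    ∃ δ : ℕ → ℕ → ℕ, ∀ (x y : Fin d → R) (a b : ℕ),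
      (∀ i, x i ∈ IsLocalRing.maximalIdeal R) →
      modLength R (R ⧸ Ideal.span (Set.range x)) ≤ (a : WithBot ℕ∞) →
      y ⟨d - 1, by omega⟩ ∉
        Ideal.span (x '' {i : Fin d | (i : ℕ) < d - 1}) +
          IsLocalRing.maximalIdeal R ^ (b + 1) →
      (∑ i, x i * y i) ∉ IsLocalRing.maximalIdeal R ^ (δ a b + 1) := by
  let l : Fin d := ⟨d - 1, by omega⟩
  have hl (i : Fin d) (hi : i ≠ l) : (i : ℕ) < l := by
    have : (i : ℕ) ≠ d - 1 := fun h ↦ hi (Fin.ext h)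
    have : (l : ℕ) = d - 1 := rfl
    omega
  have hset : {i : Fin d | (i : ℕ) < d - 1} = {l}ᶜ :=
    Set.ext fun i ↦ ⟨fun h h' ↦ (show i < l from h).ne h', hl i⟩
  constructor
  · intro hreg
    refine ⟨fun a b ↦ a + b, fun x y a b hx ha hy ↦ ?_⟩
    refine sum_mul_notMem_of_isRegular l hl hx (hreg x hx fun h ↦ ?_) ha hy
    rw [h, top_le_iff] at ha
    exact ENat.natCast_ne_top a (WithBot.coe_injective ha)
  · rintro ⟨δ, hδ⟩ x hx hfin
    rw [hset] at hδ
    exact isRegular_of_forall_mem_span_compl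
      (fun x hx hfin i r ↦ mem_span_compl_of_uniform_bound l δ hδ hx hfin i) hx hfin
end
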